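/- There exists a function φ : ℝ_{>0} → ℝ_{>0} such that for every c > 0, every m ∈ ℕ with m ≥ 2, every ε ∈ [-1,1], every even integer p with |p| ≤ c·√(log m · s_1) and |p| ≤ 2·s_1, and every adversary strategy b in the c-hypergeometric game with m rounds, parameter ε and value p, the bias achieved by b satisfies |E[O_I − O_I⁻]| ≤ φ(c)·log³ m / m. -/

import Mathlib

noncomputable def binPMF (n : ℕ) (ε : ℝ) (k : ℤ) : ℝ :=
  if ((n : ℤ) + k) % 2 = 0 ∧ -(n : ℤ) ≤ k ∧ k ≤ (n : ℤ) then
    (n.choose (((n : ℤ) + k) / 2).toNat : ℝ) *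
      ((1 + ε) / 2) ^ (((n : ℤ) + k) / 2).toNat *
      ((1 - ε) / 2) ^ (((n : ℤ) - k) / 2).toNat
  else 0

noncomputable def binTail (n : ℕ) (ε : ℝ) (k : ℤ) : ℝ :=
  ∑ t ∈ Finset.Icc k (n : ℤ), binPMF n ε t

noncomputable def hypPMF (n : ℕ) (p : ℤ) (l : ℕ) (k : ℤ) : ℝ :=
  if ((l : ℤ) + k) % 2 = 0 ∧ -(l : ℤ) ≤ k ∧ k ≤ (l : ℤ) then
    ((((n : ℤ) + p) / 2).toNat.choose (((l : ℤ) + k) / 2).toNat *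
        (((n : ℤ) - p) / 2).toNat.choose (((l : ℤ) - k) / 2).toNat : ℝ) / (n.choose l : ℝ)
  else 0

noncomputable def hypTail (n : ℕ) (p : ℤ) (l : ℕ) (k : ℤ) : ℝ :=
  ∑ t ∈ Finset.Icc k (l : ℤ), hypPMF n p l t

def lRound (m i : ℕ) : ℕ := m + 1 - i

def sRound (m i : ℕ) : ℕ := ∑ j ∈ Finset.Icc i m, lRound m j

/-- `Y_r`: the partial sum `k₀ + X_1 + ⋯ + X_r` along a trajectory of coin outcomes. -/
def partY (m : ℕ) (k0 : ℤ) (x : Fin m → ℤ) (r : ℕ) : ℤ :=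
  k0 + ∑ j ∈ Finset.univ.filter (fun j : Fin m => (j : ℕ) < r), x j

/-- Probability of a full trajectory of coins and hints in the online binomial game:
round `i+1` flips `ℓ_{i+1} = m - i` coins (summing to `x i`) and then samples the hint
`h i` from the distribution `hint (i+1) (Y_{i+1})`. -/
noncomputable def trajProb {H : Type} (m : ℕ) (ε : ℝ) (k0 : ℤ) (hint : ℕ → ℤ → H → ℝ)
    (x : Fin m → ℤ) (h : Fin m → H) : ℝ :=
  ∏ i : Fin m,
    (binPMF (lRound m ((i : ℕ) + 1)) ε (x i) *
      hint ((i : ℕ) + 1) (partY m k0 x ((i : ℕ) + 1)) (h i))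

/-- `O_r⁻ = Pr[Y_m ≥ 0 ∣ Y_{r-1} = y]`. -/
noncomputable def roundOminus (m : ℕ) (ε : ℝ) (r : ℕ) (y : ℤ) : ℝ :=
  binTail (sRound m r) ε (-y)

/-- `O_r = Pr[Y_m ≥ 0 ∣ Y_{r-1} = y, H_r = hv]`, computed by Bayes' rule over the value
of the round-`r` coin sum. -/
noncomputable def roundO {H : Type} (m : ℕ) (ε : ℝ) (hint : ℕ → ℤ → H → ℝ)
    (r : ℕ) (y : ℤ) (hv : H) : ℝ :=
  (∑ z ∈ Finset.Icc (-(lRound m r : ℤ)) (lRound m r : ℤ),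
      binPMF (lRound m r) ε z * hint r (y + z) hv * binTail (sRound m (r + 1)) ε (-(y + z))) /
  (∑ z ∈ Finset.Icc (-(lRound m r : ℤ)) (lRound m r : ℤ),
      binPMF (lRound m r) ε z * hint r (y + z) hv)

/-- The first round (as an element of `Fin m`, round `i` corresponding to `(i : ℕ) + 1`)
in which the adversary strategy `b` aborts, or `none` if it never aborts. -/
noncomputable def stopIdx {H : Type} (m : ℕ) (k0 : ℤ) (b : ℕ → ℤ → H → Bool)
    (x : Fin m → ℤ) (h : Fin m → H) : Option (Fin m) :=
  if hex : (Finset.univ.filter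
      (fun i : Fin m => b ((i : ℕ) + 1) (partY m k0 x (i : ℕ)) (h i) = true)).Nonempty
  then some ((Finset.univ.filter
      (fun i : Fin m => b ((i : ℕ) + 1) (partY m k0 x (i : ℕ)) (h i) = true)).min' hex)
  else none

/-- `O_I - O_I⁻` along a trajectory; it is `0` when the adversary never aborts, since
`O_{m+1} = O_{m+1}⁻`. -/
noncomputable def trajGain {H : Type} (m : ℕ) (ε : ℝ) (k0 : ℤ) (hint : ℕ → ℤ → H → ℝ)
    (b : ℕ → ℤ → H → Bool) (x : Fin m → ℤ) (h : Fin m → H) : ℝ :=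
  match stopIdx m k0 b x h with
  | some i =>
      roundO m ε hint ((i : ℕ) + 1) (partY m k0 x (i : ℕ)) (h i) -
        roundOminus m ε ((i : ℕ) + 1) (partY m k0 x (i : ℕ))
  | none => 0

/-- The bias `|E[O_I - O_I⁻]|` achieved by the adversary strategy `b` in the online
binomial game with `m` rounds, coin parameter `ε`, offset `k0` and hint distributions
`hint`. -/
noncomputable def gameBias {H : Type} (m : ℕ) (ε : ℝ) (k0 : ℤ) (hint : ℕ → ℤ → H → ℝ)
    (b : ℕ → ℤ → H → Bool) : ℝ :=
  |∑' q : (Fin m → ℤ) × (Fin m → H),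
      trajProb m ε k0 hint q.1 q.2 * trajGain m ε k0 hint b q.1 q.2|

/-- The hint distribution of the `c`-hypergeometric game with value `p`: in round `r`,
the hint is `true` with probability `VH(2·s_1, p, s_{r+1})(-y)` given `Y_r = y`. -/
noncomputable def hyperHint (m : ℕ) (p : ℤ) : ℕ → ℤ → Bool → ℝ := fun r y hv =>
  if hv then hypTail (2 * sRound m 1) p (sRound m (r + 1)) (-y)
  else 1 - hypTail (2 * sRound m 1) p (sRound m (r + 1)) (-y)

theorem sum_Icc_of_parity {M : Type*} [AddCommMonoid M] (n : ℕ) (F : ℤ → M)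
    (hF : ∀ z, ((n : ℤ) + z) % 2 ≠ 0 → F z = 0) :
    ∑ z ∈ Finset.Icc (-(n : ℤ)) n, F z = ∑ u ∈ Finset.range (n + 1), F (2 * u - n) := by
  have hinj : Function.Injective (fun u : ℕ => (2 * (u : ℤ) - n)) := by
    intro a b h
    simp only at h
    omega
  rw [← Finset.sum_image (f := F) (g := fun u : ℕ => (2 * (u : ℤ) - n)) hinj.injOn]
  symm
  apply Finset.sum_subset
  · intro z hz
    simp only [Finset.mem_image, Finset.mem_range, Finset.mem_Icc] at hz ⊢
    omega
  · intro z hz hz'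
    apply hF
    intro h
    apply hz'
    simp only [Finset.mem_image, Finset.mem_range, Finset.mem_Icc] at hz ⊢
    exact ⟨(((n : ℤ) + z) / 2).toNat, by omega, by omega⟩

theorem binPMF_two_mul_sub (n : ℕ) (ε : ℝ) (u : ℕ) (hu : u ≤ n) :
    binPMF n ε (2 * u - n) = (n.choose u : ℝ) * ((1 + ε) / 2) ^ u * ((1 - ε) / 2) ^ (n - u) := by
  have h1 : (((n : ℤ) + (2 * u - n)) / 2).toNat = u := by omega
  have h2 : (((n : ℤ) - (2 * u - n)) / 2).toNat = n - u := by omega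
  rw [binPMF, if_pos (by omega), h1, h2]

theorem binPMF_of_parity (n : ℕ) (ε : ℝ) (z : ℤ) (h : ((n : ℤ) + z) % 2 ≠ 0) :
    binPMF n ε z = 0 := by
  rw [binPMF, if_neg (by tauto)]

theorem binPMF_of_notMem (n : ℕ) (ε : ℝ) (z : ℤ) (h : z ∉ Finset.Icc (-(n : ℤ)) n) :
    binPMF n ε z = 0 := by
  rw [Finset.mem_Icc] at h
  rw [binPMF, if_neg (by tauto)]

theorem binPMF_nonneg (n : ℕ) {ε : ℝ} (hε : ε ∈ Set.Icc (-1 : ℝ) 1) (z : ℤ) :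
    0 ≤ binPMF n ε z := by
  have h1 : 0 ≤ (1 + ε) / 2 := by linarith [hε.1]
  have h2 : 0 ≤ (1 - ε) / 2 := by linarith [hε.2]
  rw [binPMF]
  split_ifs <;> positivity

/-- The generating function of the binomial distribution, with values in an algebra. -/
theorem sum_binPMF_smul {R : Type*} [CommRing R] [Algebra ℝ R] (n : ℕ) (ε : ℝ) (F : ℤ → R)
    (h0 : F 0 = 1) (hadd : ∀ a b, F (a + b) = F a * F b) :
    ∑ z ∈ Finset.Icc (-(n : ℤ)) n, binPMF n ε z • F z =
      (((1 + ε) / 2) • F 1 + ((1 - ε) / 2) • F (-1)) ^ n := by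
  rw [sum_Icc_of_parity _ _ (fun z hz => by rw [binPMF_of_parity n ε z hz, zero_smul]), add_pow]
  apply Finset.sum_congr rfl
  intro u hu
  have hu' : u ≤ n := by simpa [Nat.lt_succ_iff] using hu
  rw [binPMF_two_mul_sub n ε u hu']
  have hpow : ∀ (a : ℤ) (k : ℕ), F (k * a) = F a ^ k := by
    intro a k
    induction k with
    | zero => simpa using h0
    | succ k ih => rw [pow_succ, ← ih, ← hadd]; congr 1; push_cast; ring
  have h1 : F (2 * u - n) = F 1 ^ u * F (-1) ^ (n - u) := by
    rw [← hpow, ← hpow, ← hadd]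
    congr 1
    push_cast [hu']
    ring
  rw [h1, smul_pow, smul_pow, smul_mul_smul_comm]
  simp only [Algebra.smul_def, map_mul, map_natCast]
  ring

open LaurentPolynomial in
/-- Evaluation of a real function against the coefficients of a Laurent polynomial. -/
noncomputable def laurentPairing (f : ℤ → ℝ) : ℝ[T;T⁻¹] →+ ℝ where
  toFun p := p.coeff.sum fun z a => a * f z
  map_zero' := by simp
  map_add' p q := by
    rw [AddMonoidAlgebra.coeff_add, Finsupp.sum_add_index'] <;> intros <;> ring

open LaurentPolynomial in
theorem laurentPairing_smul_T (f : ℤ → ℝ) (a : ℝ) (z : ℤ) :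
    laurentPairing f (a • T z) = a * f z := by
  have : (a • T z : ℝ[T;T⁻¹]).coeff = Finsupp.single z a := by
    rw [AddMonoidAlgebra.coeff_smul, T, AddMonoidAlgebra.coeff_single, Finsupp.smul_single,
      smul_eq_mul, mul_one]
  change (a • T z : ℝ[T;T⁻¹]).coeff.sum (fun z a => a * f z) = _
  rw [this, Finsupp.sum_single_index (by ring)]

open LaurentPolynomial in
theorem sum_binPMF_smul_T (n : ℕ) (ε : ℝ) :
    ∑ z ∈ Finset.Icc (-(n : ℤ)) n, binPMF n ε z • (T z : ℝ[T;T⁻¹]) =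
      (((1 + ε) / 2) • T 1 + ((1 - ε) / 2) • T (-1)) ^ n :=
  sum_binPMF_smul n ε _ T_zero T_add

theorem sum_binPMF (n : ℕ) (ε : ℝ) : ∑ z ∈ Finset.Icc (-(n : ℤ)) n, binPMF n ε z = 1 := by
  have h := sum_binPMF_smul n ε (fun _ => (1 : ℝ)) rfl (by simp)
  simp only [smul_eq_mul, mul_one] at h
  rw [h, show (1 + ε) / 2 + (1 - ε) / 2 = 1 by ring, one_pow]

open LaurentPolynomial in
/-- The sum of independent binomials over a subset of the coordinates is binomial. -/
theorem sum_piFinset_binPMF {ι : Type*} [Fintype ι] [DecidableEq ι] (l : ι → ℕ) (ε : ℝ)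
    (J : Finset ι) (f : ℤ → ℝ) :
    ∑ x ∈ Fintype.piFinset (fun j => Finset.Icc (-(l j : ℤ)) (l j)),
        (∏ j, binPMF (l j) ε (x j)) * f (∑ j ∈ J, x j) =
      ∑ z ∈ Finset.Icc (-((∑ j ∈ J, l j : ℕ) : ℤ)) (∑ j ∈ J, l j : ℕ),
        binPMF (∑ j ∈ J, l j) ε z * f z := by
  have hT : ∀ x : ι → ℤ, (T (∑ j ∈ J, x j) : ℝ[T;T⁻¹]) = ∏ j, if j ∈ J then T (x j) else 1 := by
    intro x
    rw [Finset.prod_ite_mem, Finset.univ_inter]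
    induction J using Finset.induction_on with
    | empty => simp
    | insert a s ha ih => rw [Finset.sum_insert ha, Finset.prod_insert ha, T_add, ih]
  have key : ∑ x ∈ Fintype.piFinset (fun j => Finset.Icc (-(l j : ℤ)) (l j)),
        (∏ j, binPMF (l j) ε (x j)) • (T (∑ j ∈ J, x j) : ℝ[T;T⁻¹]) =
      ∑ z ∈ Finset.Icc (-((∑ j ∈ J, l j : ℕ) : ℤ)) (∑ j ∈ J, l j : ℕ),
        binPMF (∑ j ∈ J, l j) ε z • T z := by
    rw [sum_binPMF_smul_T]
    have h1 : ∀ x : ι → ℤ, (∏ j, binPMF (l j) ε (x j)) • (T (∑ j ∈ J, x j) : ℝ[T;T⁻¹]) =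
        ∏ j, (binPMF (l j) ε (x j) • if j ∈ J then (T (x j) : ℝ[T;T⁻¹]) else 1) := by
      intro x
      rw [hT, Finset.prod_smul]
    simp_rw [h1]
    rw [← Finset.prod_univ_sum (fun j => Finset.Icc (-(l j : ℤ)) (l j))
      (fun j z => binPMF (l j) ε z • if j ∈ J then (T z : ℝ[T;T⁻¹]) else 1),
      ← Finset.prod_pow_eq_pow_sum]
    have h2 : ∀ j, (∑ z ∈ Finset.Icc (-(l j : ℤ)) (l j),
        binPMF (l j) ε z • if j ∈ J then (T z : ℝ[T;T⁻¹]) else 1) =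
        if j ∈ J then (((1 + ε) / 2) • T 1 + ((1 - ε) / 2) • T (-1)) ^ l j else 1 := by
      intro j
      split_ifs
      · exact sum_binPMF_smul_T _ _
      · rw [← Finset.sum_smul, sum_binPMF, one_smul]
    simp_rw [h2]
    rw [Finset.prod_ite_mem, Finset.univ_inter]
  have := congrArg (laurentPairing f) key
  simpa only [map_sum, laurentPairing_smul_T] using this

open LaurentPolynomial in
/-- Convolution of two binomial distributions. -/
theorem sum_binPMF_mul_sum_binPMF (a b : ℕ) (ε : ℝ) (f : ℤ → ℝ) :
    ∑ z ∈ Finset.Icc (-(a : ℤ)) a, binPMF a ε z *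
        ∑ w ∈ Finset.Icc (-(b : ℤ)) b, binPMF b ε w * f (z + w) =
      ∑ z ∈ Finset.Icc (-((a + b : ℕ) : ℤ)) (a + b : ℕ), binPMF (a + b) ε z * f z := by
  have key : ∑ z ∈ Finset.Icc (-(a : ℤ)) a, ∑ w ∈ Finset.Icc (-(b : ℤ)) b,
        (binPMF a ε z * binPMF b ε w) • (T (z + w) : ℝ[T;T⁻¹]) =
      ∑ z ∈ Finset.Icc (-((a + b : ℕ) : ℤ)) (a + b : ℕ), binPMF (a + b) ε z • T z := by
    rw [sum_binPMF_smul_T, pow_add, ← sum_binPMF_smul_T, ← sum_binPMF_smul_T, Finset.sum_mul_sum]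
    simp only [T_add, smul_mul_smul_comm]
  have := congrArg (laurentPairing f) key
  simp only [map_sum, laurentPairing_smul_T] at this
  rw [← this]
  simp only [Finset.mul_sum, mul_assoc]

theorem sum_binPMF_exp (n : ℕ) (ε t : ℝ) :
    ∑ z ∈ Finset.Icc (-(n : ℤ)) n, binPMF n ε z * Real.exp (t * z) =
      (Real.cosh t + ε * Real.sinh t) ^ n := by
  have h := sum_binPMF_smul n ε (fun z => Real.exp (t * z)) (by simp)
    (fun a b => by rw [← Real.exp_add]; push_cast; ring_nf)
  simp only [smul_eq_mul] at h
  rw [h, Real.cosh_eq, Real.sinh_eq]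
  congr 1
  push_cast
  ring_nf

theorem cosh_add_mul_sinh_le {ε : ℝ} (hε : ε ∈ Set.Icc (-1 : ℝ) 1) (t : ℝ) :
    Real.cosh t + ε * Real.sinh t ≤ Real.exp (t ^ 2 + ε * t) := by
  have h1 : Real.exp (-(ε * t)) ≤ Real.cosh t - ε * Real.sinh t := by
    have h := convexOn_exp.2 (Set.mem_univ (-t)) (Set.mem_univ t)
      (show 0 ≤ (1 + ε) / 2 by linarith [hε.1]) (show 0 ≤ (1 - ε) / 2 by linarith [hε.2]) (by ring)
    simp only [smul_eq_mul] at h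
    rw [Real.cosh_eq, Real.sinh_eq]
    calc Real.exp (-(ε * t)) = Real.exp ((1 + ε) / 2 * -t + (1 - ε) / 2 * t) := by ring_nf
      _ ≤ _ := h
      _ = _ := by ring
  have h2 : (Real.cosh t + ε * Real.sinh t) * (Real.cosh t - ε * Real.sinh t) ≤
      Real.exp (t ^ 2) := by
    calc _ = Real.cosh t ^ 2 - ε ^ 2 * Real.sinh t ^ 2 := by ring
      _ ≤ Real.cosh t ^ 2 := by nlinarith [mul_nonneg (sq_nonneg ε) (sq_nonneg (Real.sinh t))]
      _ ≤ Real.exp (t ^ 2 / 2) ^ 2 :=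
        pow_le_pow_left₀ (Real.cosh_pos t).le (Real.cosh_le_exp_half_sq t) 2
      _ = _ := by rw [← Real.exp_nat_mul]; push_cast; ring_nf
  have h0 : 0 ≤ Real.cosh t + ε * Real.sinh t := by
    rw [Real.cosh_eq, Real.sinh_eq]
    nlinarith [mul_nonneg (by linarith [hε.1] : 0 ≤ 1 + ε) (Real.exp_pos t).le,
      mul_nonneg (by linarith [hε.2] : 0 ≤ 1 - ε) (Real.exp_pos (-t)).le]
  calc Real.cosh t + ε * Real.sinh t
      = (Real.cosh t + ε * Real.sinh t) * Real.exp (-(ε * t)) * Real.exp (ε * t) := by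
        rw [mul_assoc, ← Real.exp_add]; simp
    _ ≤ (Real.cosh t + ε * Real.sinh t) * (Real.cosh t - ε * Real.sinh t) * Real.exp (ε * t) := by
        gcongr
    _ ≤ Real.exp (t ^ 2) * Real.exp (ε * t) := by gcongr
    _ = _ := by rw [← Real.exp_add]

/-- Sub-Gaussian bound for the moment generating function of the binomial distribution. -/
theorem sum_binPMF_exp_le (n : ℕ) {ε : ℝ} (hε : ε ∈ Set.Icc (-1 : ℝ) 1) (t : ℝ) :
    ∑ z ∈ Finset.Icc (-(n : ℤ)) n, binPMF n ε z * Real.exp (t * z) ≤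
      Real.exp (n * (t ^ 2 + ε * t)) := by
  rw [sum_binPMF_exp, Real.exp_nat_mul]
  refine pow_le_pow_left₀ ?_ (cosh_add_mul_sinh_le hε t) n
  rw [Real.cosh_eq, Real.sinh_eq]
  nlinarith [mul_nonneg (by linarith [hε.1] : 0 ≤ 1 + ε) (Real.exp_pos t).le,
    mul_nonneg (by linarith [hε.2] : 0 ≤ 1 - ε) (Real.exp_pos (-t)).le]

/-- Chernoff bound for sets on which `t * (z - ε n)` is bounded below. -/
theorem sum_binPMF_indicator_le (n : ℕ) {ε : ℝ} (hε : ε ∈ Set.Icc (-1 : ℝ) 1) (t τ : ℝ)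
    (f : ℤ → ℝ) (hf1 : ∀ z, f z ≤ 1) (hf : ∀ z : ℤ, t * (z - ε * n) < τ → f z ≤ 0) :
    ∑ z ∈ Finset.Icc (-(n : ℤ)) n, binPMF n ε z * f z ≤ Real.exp (n * t ^ 2 - τ) := by
  calc ∑ z ∈ Finset.Icc (-(n : ℤ)) n, binPMF n ε z * f z
      ≤ ∑ z ∈ Finset.Icc (-(n : ℤ)) n, binPMF n ε z * Real.exp (t * z) *
          Real.exp (-(ε * t * n) - τ) := by
        apply Finset.sum_le_sum
        intro z _
        rw [mul_assoc, ← Real.exp_add]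
        refine mul_le_mul_of_nonneg_left ?_ (binPMF_nonneg n hε z)
        by_cases h : t * (z - ε * n) < τ
        · exact (hf z h).trans (Real.exp_pos _).le
        · refine (hf1 z).trans (Real.one_le_exp ?_)
          linarith
    _ ≤ Real.exp (n * (t ^ 2 + ε * t)) * Real.exp (-(ε * t * n) - τ) := by
        rw [← Finset.sum_mul]
        gcongr
        exact sum_binPMF_exp_le n hε t
    _ = _ := by rw [← Real.exp_add]; ring_nf

theorem sum_Icc_tail_eq (l : ℕ) (P : ℤ → ℝ) (hP : ∀ z, z ∉ Finset.Icc (-(l : ℤ)) l → P z = 0)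
    (j : ℤ) :
    ∑ t ∈ Finset.Icc j (l : ℤ), P t =
      ∑ t ∈ Finset.Icc (-(l : ℤ)) l, P t * (if j ≤ t then 1 else 0) := by
  simp only [mul_ite, mul_one, mul_zero]
  rw [← Finset.sum_filter]
  symm
  apply Finset.sum_subset
  · intro t ht
    simp only [Finset.mem_filter, Finset.mem_Icc] at ht ⊢
    omega
  · intro t ht ht'
    apply hP
    intro h
    simp only [Finset.mem_filter, Finset.mem_Icc] at ht ht' h
    omega

theorem hypPMF_of_notMem (n : ℕ) (p : ℤ) (l : ℕ) (z : ℤ) (h : z ∉ Finset.Icc (-(l : ℤ)) l) :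
    hypPMF n p l z = 0 := by
  rw [Finset.mem_Icc] at h
  rw [hypPMF, if_neg (by tauto)]

theorem hypPMF_of_parity (n : ℕ) (p : ℤ) (l : ℕ) (z : ℤ) (h : ((l : ℤ) + z) % 2 ≠ 0) :
    hypPMF n p l z = 0 := by
  rw [hypPMF, if_neg (by tauto)]

theorem hypPMF_nonneg (n : ℕ) (p : ℤ) (l : ℕ) (z : ℤ) : 0 ≤ hypPMF n p l z := by
  rw [hypPMF]
  split_ifs <;> positivity

theorem hypPMF_two_mul_sub (n : ℕ) (p : ℤ) (l u : ℕ) (hu : u ≤ l) :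
    hypPMF n p l (2 * u - l) = ((((n : ℤ) + p) / 2).toNat.choose u *
      (((n : ℤ) - p) / 2).toNat.choose (l - u) : ℝ) / (n.choose l : ℝ) := by
  have h1 : (((l : ℤ) + (2 * u - l)) / 2).toNat = u := by omega
  have h2 : (((l : ℤ) - (2 * u - l)) / 2).toNat = l - u := by omega
  rw [hypPMF, if_pos (by omega), h1, h2]

theorem hypPMF_neg (n : ℕ) (p : ℤ) (l : ℕ) (z : ℤ) : hypPMF n p l (-z) = hypPMF n (-p) l z := by
  rw [hypPMF, hypPMF]
  by_cases h : ((l : ℤ) + z) % 2 = 0 ∧ -(l : ℤ) ≤ z ∧ z ≤ l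
  · rw [if_pos (by omega), if_pos h, sub_neg_eq_add, sub_neg_eq_add, ← sub_eq_add_neg,
      ← sub_eq_add_neg, mul_comm]
  · rw [if_neg (by omega), if_neg h]

/-- Vandermonde's identity: the hypergeometric weights sum to one. -/
theorem sum_hypPMF (n : ℕ) (p : ℤ) (l : ℕ) (hp : ((n : ℤ) + p) % 2 = 0) (hp1 : -(n : ℤ) ≤ p)
    (hp2 : p ≤ n) (hl : l ≤ n) : ∑ z ∈ Finset.Icc (-(l : ℤ)) l, hypPMF n p l z = 1 := by
  rw [sum_Icc_of_parity _ _ (hypPMF_of_parity n p l)]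
  have hn : n = (((n : ℤ) + p) / 2).toNat + (((n : ℤ) - p) / 2).toNat := by omega
  have h0 : (n.choose l : ℝ) ≠ 0 := by exact_mod_cast (Nat.choose_pos hl).ne'
  have hv : ((n.choose l : ℕ) : ℝ) = ∑ u ∈ Finset.range (l + 1),
      ((((n : ℤ) + p) / 2).toNat.choose u * (((n : ℤ) - p) / 2).toNat.choose (l - u) : ℝ) := by
    conv_lhs => rw [hn]
    rw [Nat.add_choose_eq, Finset.Nat.sum_antidiagonal_eq_sum_range_succ_mk]
    push_cast
    rfl
  rw [Finset.sum_congr rfl (fun u hu => hypPMF_two_mul_sub n p l u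
    (by simpa [Nat.lt_succ_iff] using hu)), ← Finset.sum_div, ← hv, div_self h0]

theorem hypTail_eq (n : ℕ) (p : ℤ) (l : ℕ) (j : ℤ) : hypTail n p l j =
    ∑ t ∈ Finset.Icc (-(l : ℤ)) l, hypPMF n p l t * (if j ≤ t then 1 else 0) :=
  sum_Icc_tail_eq l _ (hypPMF_of_notMem n p l) j

theorem binTail_eq (n : ℕ) (ε : ℝ) (j : ℤ) : binTail n ε j =
    ∑ t ∈ Finset.Icc (-(n : ℤ)) n, binPMF n ε t * (if j ≤ t then 1 else 0) :=
  sum_Icc_tail_eq n _ (binPMF_of_notMem n ε) j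

theorem hypTail_nonneg (n : ℕ) (p : ℤ) (l : ℕ) (j : ℤ) : 0 ≤ hypTail n p l j :=
  Finset.sum_nonneg fun _ _ => hypPMF_nonneg _ _ _ _

theorem one_sub_hypTail (n : ℕ) (p : ℤ) (l : ℕ) (hp : ((n : ℤ) + p) % 2 = 0)
    (hp1 : -(n : ℤ) ≤ p) (hp2 : p ≤ n) (hl : l ≤ n) (w : ℤ) :
    1 - hypTail n p l (-w) = hypTail n (-p) l (w + 1) := by
  rw [← sum_hypPMF n p l hp hp1 hp2 hl, hypTail_eq, hypTail_eq, ← Finset.sum_sub_distrib]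
  refine Finset.sum_nbij' (fun t => -t) (fun t => -t) ?_ ?_ (by simp) (by simp) ?_
  · intro t ht
    simp only [Finset.mem_Icc] at ht ⊢
    omega
  · intro t ht
    simp only [Finset.mem_Icc] at ht ⊢
    omega
  · intro t _
    rw [← hypPMF_neg, neg_neg]
    by_cases h : -w ≤ t
    · rw [if_pos h, if_neg (by omega)]; ring
    · rw [if_neg h, if_pos (by omega)]; ring

theorem sum_Icc_tail_succ (l : ℕ) (P : ℤ → ℝ) (hP : ∀ z, z ∉ Finset.Icc (-(l : ℤ)) l → P z = 0)
    (j : ℤ) :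
    ∑ t ∈ Finset.Icc j (l : ℤ), P t = P j + ∑ t ∈ Finset.Icc (j + 1) (l : ℤ), P t := by
  by_cases h : j ≤ l
  · rw [← Finset.sum_insert (by simp)]
    congr 1
    ext t
    simp only [Finset.mem_Icc, Finset.mem_insert]
    omega
  · rw [Finset.Icc_eq_empty (by omega), Finset.Icc_eq_empty (by omega), hP j (by
      simp only [Finset.mem_Icc]; omega)]
    simp

/-- If a nonnegative weight decays slowly to the right of `j`, then its value at `j` is a small
fraction of its upper tail. -/
theorem le_mul_tail_of_slow_decay (l : ℕ) (P : ℤ → ℝ) (h0 : ∀ z, 0 ≤ P z)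
    (hP : ∀ z, z ∉ Finset.Icc (-(l : ℤ)) l → P z = 0) {a : ℝ} (ha : 0 < a) (ha' : a ≤ 1 / 4)
    (j : ℤ) (hj : ∀ t : ℕ, (2 * t : ℝ) ≤ 1 / a → (1 - a) * P (j + 2 * t) ≤ P (j + 2 * t + 2)) :
    P j ≤ 4 * a * ∑ t ∈ Finset.Icc j (l : ℤ), P t := by
  set N : ℕ := ⌊1 / (2 * a)⌋₊ with hN
  have hNle : (N : ℝ) ≤ 1 / (2 * a) := Nat.floor_le (by positivity)
  have hNlt : 1 / (2 * a) < N + 1 := Nat.lt_floor_add_one _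
  have hpow : ∀ t : ℕ, t ≤ N → (1 - a) ^ t * P j ≤ P (j + 2 * t) := by
    intro t
    induction t with
    | zero => intro _; simp
    | succ t ih =>
      intro ht
      have h1 := ih (by omega)
      have h2 : (2 * t : ℝ) ≤ 1 / a := by
        have : (t : ℝ) ≤ N := by exact_mod_cast (by omega : t ≤ N)
        calc (2 * t : ℝ) ≤ 2 * (1 / (2 * a)) := by linarith
          _ = 1 / a := by field_simp
      calc (1 - a) ^ (t + 1) * P j = (1 - a) * ((1 - a) ^ t * P j) := by ring
        _ ≤ (1 - a) * P (j + 2 * t) := mul_le_mul_of_nonneg_left h1 (by linarith)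
        _ ≤ P (j + 2 * t + 2) := hj t h2
        _ = _ := by push_cast; ring_nf
  have hhalf : ∀ t ∈ Finset.range (N + 1), P j / 2 ≤ P (j + 2 * t) := by
    intro t ht
    have ht' : t ≤ N := by simpa [Nat.lt_succ_iff] using ht
    have hb := one_add_mul_le_pow (show (-2 : ℝ) ≤ -a by linarith) t
    have htN : (t : ℝ) ≤ 1 / (2 * a) := le_trans (by exact_mod_cast ht') hNle
    have hta : (t : ℝ) * a ≤ 1 / 2 := by
      calc (t : ℝ) * a ≤ 1 / (2 * a) * a := by gcongr
        _ = 1 / 2 := by field_simp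
    have h3 : 1 / 2 ≤ (1 - a) ^ t := by
      rw [← sub_eq_add_neg 1 a] at hb
      linarith
    calc P j / 2 = 1 / 2 * P j := by ring
      _ ≤ (1 - a) ^ t * P j := mul_le_mul_of_nonneg_right h3 (h0 j)
      _ ≤ _ := hpow t ht'
  have hsum : ∑ t ∈ Finset.range (N + 1), P (j + 2 * t) ≤ ∑ t ∈ Finset.Icc j (l : ℤ), P t := by
    rw [← Finset.sum_image (f := P) (g := fun t : ℕ => j + 2 * (t : ℤ))
      (fun a _ b _ h => by simp only at h; omega)]
    rw [← Finset.sum_filter_of_ne (p := fun z => z ≤ (l : ℤ))]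
    · refine Finset.sum_le_sum_of_subset_of_nonneg ?_ (fun z _ _ => h0 z)
      intro z hz
      simp only [Finset.mem_filter, Finset.mem_image, Finset.mem_range, Finset.mem_Icc] at hz ⊢
      omega
    · intro z _ hz
      by_contra h
      exact hz (hP z (by simp only [Finset.mem_Icc]; omega))
  have hcard := Finset.card_nsmul_le_sum _ _ _ hhalf
  rw [Finset.card_range, nsmul_eq_mul] at hcard
  push_cast at hcard
  have h5 : 1 / (2 * a) * (P j / 2) ≤ ∑ t ∈ Finset.Icc j (l : ℤ), P t :=
    (mul_le_mul_of_nonneg_right hNlt.le (by linarith [h0 j])).trans (hcard.trans hsum)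
  calc P j = 4 * a * (1 / (2 * a) * (P j / 2)) := by field_simp; ring
    _ ≤ _ := by gcongr

theorem binPMF_slow_decay {N : ℕ} {ε θ : ℝ} (hε : |ε| ≤ θ) (hθ : 0 < θ) (hθ' : θ ≤ 1 / 64)
    (hN : 1 ≤ θ ^ 2 * N) (j : ℤ) (hj : |(j : ℝ)| ≤ 2 * θ * N) :
    (1 - 16 * θ) * binPMF N ε j ≤ binPMF N ε (j + 2) := by
  by_cases hpar : ((N : ℤ) + j) % 2 = 0
  swap
  · rw [binPMF_of_parity _ _ _ hpar, binPMF_of_parity _ _ _ (by omega)]; simp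
  obtain ⟨hε1, hε2⟩ := abs_le.1 hε
  obtain ⟨hj1, hj2⟩ := abs_le.1 hj
  have hNpos : (0 : ℝ) < N := by
    by_contra h
    nlinarith [sq_nonneg θ]
  have hjN : |(j : ℝ)| < N := by nlinarith
  have hjN1 : -(N : ℤ) < j := by exact_mod_cast (abs_lt.1 hjN).1
  have hjN2 : j < N := by exact_mod_cast (abs_lt.1 hjN).2
  obtain ⟨u, hu⟩ : ∃ u : ℕ, j = 2 * u - N := ⟨(((N : ℤ) + j) / 2).toNat, by omega⟩
  have huN : u + 1 ≤ N := by omega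
  have hujr : (j : ℝ) = 2 * u - N := by exact_mod_cast hu
  rw [show j + 2 = 2 * ((u + 1 : ℕ) : ℤ) - N by push_cast; omega, hu,
    binPMF_two_mul_sub _ _ _ (by omega), binPMF_two_mul_sub _ _ _ huN]
  have hc : ((N.choose (u + 1) : ℕ) : ℝ) * (u + 1) = N.choose u * (N - u) := by
    have := Nat.choose_succ_right_eq N u
    have h2 : ((N - u : ℕ) : ℝ) = N - u := by push_cast [show u ≤ N by omega]; ring
    rw [← h2]
    exact_mod_cast this
  have hkey : (1 - 16 * θ) * ((u + 1) * (1 - ε)) ≤ (N - u) * (1 + ε) := by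
    have h1 : (1 : ℝ) ≤ θ / 64 * N := by nlinarith
    have hu1 : (u + 1 : ℝ) ≤ N * (1 + 3 * θ) / 2 := by nlinarith
    have hu2 : N * (1 - 2 * θ) / 2 ≤ (N - u : ℝ) := by nlinarith
    calc (1 - 16 * θ) * ((u + 1) * (1 - ε))
        ≤ (1 - 16 * θ) * (N * (1 + 3 * θ) / 2 * (1 + θ)) := by
          have : 0 ≤ 1 - 16 * θ := by linarith
          have : 0 ≤ 1 - ε := by linarith
          gcongr
          linarith
      _ = N / 2 * ((1 - 16 * θ) * ((1 + 3 * θ) * (1 + θ))) := by ring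
      _ ≤ N / 2 * ((1 - 2 * θ) * (1 - θ)) := by
          refine mul_le_mul_of_nonneg_left ?_ (by positivity)
          nlinarith [mul_pos hθ hθ, mul_pos hθ (mul_pos hθ hθ)]
      _ = N * (1 - 2 * θ) / 2 * (1 - θ) := by ring
      _ ≤ (N - u) * (1 + ε) := by
          have : 0 ≤ 1 - 2 * θ := by linarith
          apply mul_le_mul hu2 (by linarith) (by linarith)
          nlinarith
  have hD : 0 < (u + 1 : ℝ) * (1 - ε) := by
    have : 0 < 1 - ε := by linarith
    positivity
  refine le_of_mul_le_mul_right ?_ hD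
  have hpow : ((1 - ε) / 2) ^ (N - u) = ((1 - ε) / 2) ^ (N - (u + 1)) * ((1 - ε) / 2) := by
    rw [← pow_succ]; congr 1; omega
  have hX : 0 ≤ (N.choose u : ℝ) * ((1 + ε) / 2) ^ u * ((1 - ε) / 2) ^ (N - u) := by
    have : 0 ≤ 1 + ε := by linarith
    have : 0 ≤ 1 - ε := by linarith
    positivity
  calc (1 - 16 * θ) * ((N.choose u : ℝ) * ((1 + ε) / 2) ^ u * ((1 - ε) / 2) ^ (N - u)) *
        ((u + 1) * (1 - ε))
      = ((N.choose u : ℝ) * ((1 + ε) / 2) ^ u * ((1 - ε) / 2) ^ (N - u)) *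
        ((1 - 16 * θ) * ((u + 1) * (1 - ε))) := by ring
    _ ≤ ((N.choose u : ℝ) * ((1 + ε) / 2) ^ u * ((1 - ε) / 2) ^ (N - u)) *
        ((N - u) * (1 + ε)) := by gcongr
    _ = (N.choose u * (N - u)) * ((1 + ε) / 2) ^ u * ((1 - ε) / 2) ^ (N - u) * (1 + ε) := by ring
    _ = _ := by rw [← hc, hpow, pow_succ]; ring

theorem hypergeometric_ratio_bound {n l u v A B p j θ : ℝ} (hln : 2 * l ≤ n) (hp1 : -(θ * n) ≤ p)
    (hp2 : p ≤ θ * n) (hθ : 0 < θ) (hθ' : θ ≤ 1 / 64) (hl : 1 ≤ θ ^ 2 * l) (hl0 : 0 < l)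
    (hj1 : -(2 * θ * l) ≤ j) (hj2 : j ≤ 2 * θ * l) (hu : j = 2 * u - l)
    (hv : l = u + (v + 1)) (hA : 2 * A = n + p) (hB : 2 * B = n - p) :
    0 < A - u ∧ 0 ≤ B - v ∧
      (1 - 16 * θ) * ((u + 1) * (B - v)) ≤ (A - u) * (v + 1) := by
  have h1 : 1 ≤ θ / 64 * l := by
    refine hl.trans (mul_le_mul_of_nonneg_right ?_ hl0.le)
    rw [sq, div_eq_mul_one_div]
    exact mul_le_mul_of_nonneg_left hθ' hθ.le
  have hθn : 0 ≤ θ * (n - 2 * l) := mul_nonneg hθ.le (by linarith)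
  have hθn' : θ * n ≤ 1 / 64 * n := mul_le_mul_of_nonneg_right hθ' (by linarith)
  have hθl' : θ * l ≤ 1 / 64 * l := mul_le_mul_of_nonneg_right hθ' hl0.le
  have hnl : 0 ≤ n - l := by linarith
  have hu1 : u + 1 ≤ l * (1 + 3 * θ) / 2 := by linarith
  have hv1 : l * (1 - 2 * θ) / 2 ≤ v + 1 := by linarith
  have hA1 : (n - l) * (1 - 4 * θ) / 2 ≤ A - u := by linarith
  have hB0 : 0 ≤ B - v := by linarith
  have hB1 : B - v ≤ (n - l) * (1 + 5 * θ) / 2 := by linarith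
  have hAu : 0 < A - u := by linarith
  refine ⟨hAu, hB0, ?_⟩
  have h16 : 0 ≤ 1 - 16 * θ := by linarith
  have h12 : 0 ≤ 1 - 2 * θ := by linarith
  calc (1 - 16 * θ) * ((u + 1) * (B - v))
      ≤ (1 - 16 * θ) * (l * (1 + 3 * θ) / 2 * ((n - l) * (1 + 5 * θ) / 2)) := by
        refine mul_le_mul_of_nonneg_left ?_ h16
        exact mul_le_mul hu1 hB1 hB0 (by positivity)
    _ = l * (n - l) / 4 * ((1 - 16 * θ) * ((1 + 3 * θ) * (1 + 5 * θ))) := by ring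
    _ ≤ l * (n - l) / 4 * ((1 - 4 * θ) * (1 - 2 * θ)) := by
        refine mul_le_mul_of_nonneg_left ?_ (by positivity)
        nlinarith [mul_pos hθ hθ, mul_pos hθ (mul_pos hθ hθ)]
    _ = (n - l) * (1 - 4 * θ) / 2 * (l * (1 - 2 * θ) / 2) := by ring
    _ ≤ (A - u) * (v + 1) := mul_le_mul hA1 hv1 (by positivity) hAu.le

theorem hypPMF_slow_decay {n l : ℕ} {p : ℤ} {θ : ℝ} (hp : ((n : ℤ) + p) % 2 = 0)
    (hln : 2 * l ≤ n) (hpθ : |(p : ℝ)| ≤ θ * n) (hθ : 0 < θ) (hθ' : θ ≤ 1 / 64)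
    (hl : 1 ≤ θ ^ 2 * l) (j : ℤ) (hj : |(j : ℝ)| ≤ 2 * θ * l) :
    (1 - 16 * θ) * hypPMF n p l j ≤ hypPMF n p l (j + 2) := by
  by_cases hpar : ((l : ℤ) + j) % 2 = 0
  swap
  · rw [hypPMF_of_parity _ _ _ _ hpar, hypPMF_of_parity _ _ _ _ (by omega)]; simp
  obtain ⟨hp1, hp2⟩ := abs_le.1 hpθ
  obtain ⟨hj1, hj2⟩ := abs_le.1 hj
  have hlpos : (0 : ℝ) < l := by
    by_contra h
    nlinarith [sq_nonneg θ]
  have hlnr : (2 * l : ℝ) ≤ n := by exact_mod_cast hln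
  have hjl : |(j : ℝ)| < l := by nlinarith
  have hjl1 : -(l : ℤ) < j := by exact_mod_cast (abs_lt.1 hjl).1
  have hjl2 : j < l := by exact_mod_cast (abs_lt.1 hjl).2
  obtain ⟨u, hu⟩ : ∃ u : ℕ, j = 2 * u - l := ⟨(((l : ℤ) + j) / 2).toNat, by omega⟩
  obtain ⟨v, hv⟩ : ∃ v : ℕ, l = u + (v + 1) := ⟨l - u - 1, by omega⟩
  have hujr : (j : ℝ) = 2 * u - l := by exact_mod_cast hu
  have hvr : (l : ℝ) = u + (v + 1) := by exact_mod_cast hv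
  have hpn : |(p : ℝ)| < n := by nlinarith
  have hpn1 : -(n : ℤ) < p := by exact_mod_cast (abs_lt.1 hpn).1
  have hpn2 : p < n := by exact_mod_cast (abs_lt.1 hpn).2
  rw [show j + 2 = 2 * ((u + 1 : ℕ) : ℤ) - l by push_cast; omega, hu,
    hypPMF_two_mul_sub _ _ _ _ (by omega), hypPMF_two_mul_sub _ _ _ _ (by omega : u + 1 ≤ l),
    show l - u = v + 1 by omega, show l - (u + 1) = v by omega, ← mul_div_assoc]
  obtain ⟨A, hA⟩ : ∃ A : ℕ, (((n : ℤ) + p) / 2) = A := ⟨(((n : ℤ) + p) / 2).toNat, by omega⟩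
  obtain ⟨B, hB⟩ : ∃ B : ℕ, (((n : ℤ) - p) / 2) = B := ⟨(((n : ℤ) - p) / 2).toNat, by omega⟩
  have hAr : (2 * A : ℝ) = n + p := by exact_mod_cast (by omega : (2 * A : ℤ) = n + p)
  have hBr : (2 * B : ℝ) = n - p := by exact_mod_cast (by omega : (2 * B : ℤ) = n - p)
  rw [hA, hB, Int.toNat_natCast, Int.toNat_natCast]
  obtain ⟨hAu, hB0, hkey⟩ := hypergeometric_ratio_bound hlnr hp1 hp2 hθ hθ' hl hlpos hj1 hj2 hujr
    hvr hAr hBr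
  have huA : u ≤ A := by exact_mod_cast (by linarith : (u : ℝ) ≤ A)
  have hvB : v ≤ B := by exact_mod_cast (by linarith : (v : ℝ) ≤ B)
  have hcA : ((A.choose (u + 1) : ℕ) : ℝ) * (u + 1) = A.choose u * (A - u) := by
    have := Nat.choose_succ_right_eq A u
    have h2 : ((A - u : ℕ) : ℝ) = A - u := by push_cast [huA]; ring
    rw [← h2]
    exact_mod_cast this
  have hcB : ((B.choose (v + 1) : ℕ) : ℝ) * (v + 1) = B.choose v * (B - v) := by
    have := Nat.choose_succ_right_eq B v
    have h2 : ((B - v : ℕ) : ℝ) = B - v := by push_cast [hvB]; ring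
    rw [← h2]
    exact_mod_cast this
  have hstep : (1 - 16 * θ) * ((A.choose u : ℝ) * B.choose (v + 1)) ≤
      (A.choose (u + 1) : ℝ) * B.choose v := by
    refine le_of_mul_le_mul_right ?_ (show (0 : ℝ) < (u + 1) * (v + 1) by positivity)
    calc (1 - 16 * θ) * ((A.choose u : ℝ) * B.choose (v + 1)) * ((u + 1) * (v + 1))
        = A.choose u * (B.choose (v + 1) * (v + 1)) * ((1 - 16 * θ) * (u + 1)) := by ring
      _ = A.choose u * B.choose v * ((1 - 16 * θ) * ((u + 1) * (B - v))) := by rw [hcB]; ring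
      _ ≤ A.choose u * B.choose v * ((A - u) * (v + 1)) := by gcongr
      _ = (A.choose u * (A - u)) * B.choose v * (v + 1) := by ring
      _ = _ := by rw [← hcA]; ring
  gcongr

theorem add_two_mul_mem_window {N θ : ℝ} (hθ : 0 < θ) (hN : 1 ≤ θ ^ 2 * N) {j : ℤ}
    (hj : |(j : ℝ)| ≤ θ * N) (t : ℕ) (ht : (2 * t : ℝ) ≤ 1 / (16 * θ)) :
    |((j + 2 * t : ℤ) : ℝ)| ≤ 2 * θ * N := by
  have h : 1 / (16 * θ) ≤ θ * N := by
    rw [div_le_iff₀ (by positivity)]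
    nlinarith
  push_cast
  calc |(j : ℝ) + 2 * t| ≤ |(j : ℝ)| + |(2 * t : ℝ)| := abs_add_le _ _
    _ = |(j : ℝ)| + 2 * t := by rw [abs_of_nonneg (by positivity : (0 : ℝ) ≤ 2 * t)]
    _ ≤ _ := by linarith

theorem binPMF_le_mul_binTail {N : ℕ} {ε θ : ℝ} (hε : |ε| ≤ θ) (hθ : 0 < θ) (hθ' : θ ≤ 1 / 64)
    (hN : 1 ≤ θ ^ 2 * N) (j : ℤ) (hj : |(j : ℝ)| ≤ θ * N) :
    binPMF N ε j ≤ 64 * θ * binTail N ε j := by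
  have hε' : ε ∈ Set.Icc (-1 : ℝ) 1 := by
    obtain ⟨h1, h2⟩ := abs_le.1 hε
    constructor <;> linarith
  have h := le_mul_tail_of_slow_decay N (binPMF N ε) (binPMF_nonneg N hε')
    (binPMF_of_notMem N ε) (a := 16 * θ) (by positivity) (by linarith) j
    (fun t ht => binPMF_slow_decay hε hθ hθ' hN _ (add_two_mul_mem_window hθ hN hj t ht))
  rw [show (64 : ℝ) * θ = 4 * (16 * θ) by ring]
  exact h

theorem hypPMF_le_mul_hypTail {n l : ℕ} {p : ℤ} {θ : ℝ} (hp : ((n : ℤ) + p) % 2 = 0)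
    (hln : 2 * l ≤ n) (hpθ : |(p : ℝ)| ≤ θ * n) (hθ : 0 < θ) (hθ' : θ ≤ 1 / 64)
    (hl : 1 ≤ θ ^ 2 * l) (j : ℤ) (hj : |(j : ℝ)| ≤ θ * l) :
    hypPMF n p l j ≤ 64 * θ * hypTail n p l j := by
  have h := le_mul_tail_of_slow_decay l (hypPMF n p l) (hypPMF_nonneg n p l)
    (hypPMF_of_notMem n p l) (a := 16 * θ) (by positivity) (by linarith) j
    (fun t ht => hypPMF_slow_decay hp hln hpθ hθ hθ' hl _ (add_two_mul_mem_window hθ hl hj t ht))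
  rw [show (64 : ℝ) * θ = 4 * (16 * θ) by ring]
  exact h

/-- On the window `[-R, R]` the function `f` changes by a factor of at least `1 - β` per step. -/
def StepRatioBound (f : ℤ → ℝ) (β R : ℝ) : Prop :=
  ∀ w : ℤ, |(w : ℝ)| ≤ R → |((w + 1 : ℤ) : ℝ)| ≤ R →
    (1 - β) * f w ≤ f (w + 1) ∧ (1 - β) * f (w + 1) ≤ f w

theorem abs_intCast_le_of_between {R : ℝ} {a b c : ℤ} (ha : |(a : ℝ)| ≤ R) (hb : |(b : ℝ)| ≤ R)
    (hac : a ≤ c) (hcb : c ≤ b) : |(c : ℝ)| ≤ R := by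
  have h1 : (a : ℝ) ≤ c := by exact_mod_cast hac
  have h2 : (c : ℝ) ≤ b := by exact_mod_cast hcb
  rw [abs_le] at *
  constructor <;> linarith

theorem StepRatioBound.le_exp_mul {f : ℤ → ℝ} {β R : ℝ} (h : StepRatioBound f β R)
    (hf : ∀ w, 0 ≤ f w) (hβ : 0 ≤ β) (hβ' : β ≤ 1 / 2) {w w' : ℤ} (hw : |(w : ℝ)| ≤ R)
    (hw' : |(w' : ℝ)| ≤ R) : f w' ≤ Real.exp (2 * β * |((w' - w : ℤ) : ℝ)|) * f w := by
  have hinv : ∀ x y : ℝ, 0 ≤ y → (1 - β) * x ≤ y → x ≤ Real.exp (2 * β) * y := by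
    intro x y hy hxy
    have h1 : 1 ≤ (1 - β) * Real.exp (2 * β) := by
      have := Real.add_one_le_exp (2 * β)
      nlinarith
    have h2 : (1 - β) * x ≤ (1 - β) * (Real.exp (2 * β) * y) := by nlinarith
    exact le_of_mul_le_mul_left h2 (by linarith)
  have key : ∀ (d : ℕ) (w : ℤ), |(w : ℝ)| ≤ R → |((w + d : ℤ) : ℝ)| ≤ R →
      f (w + d) ≤ Real.exp (2 * β * d) * f w ∧ f w ≤ Real.exp (2 * β * d) * f (w + d) := by
    intro d
    induction d with
    | zero => intro w _ _; simp
    | succ d ih =>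
      intro w h1 h2
      have h3 : |((w + d : ℤ) : ℝ)| ≤ R :=
        abs_intCast_le_of_between h1 h2 (by omega) (by push_cast; omega)
      obtain ⟨i1, i2⟩ := ih w h1 h3
      obtain ⟨s1, s2⟩ := h (w + d) h3 (by rw [add_assoc]; exact_mod_cast h2)
      have he : Real.exp (2 * β * (d + 1 : ℕ)) = Real.exp (2 * β) * Real.exp (2 * β * d) := by
        rw [← Real.exp_add]; push_cast; ring_nf
      have hw1 : w + ((d + 1 : ℕ) : ℤ) = w + d + 1 := by push_cast; ring
      rw [he, hw1]
      constructor
      · calc f (w + d + 1) ≤ Real.exp (2 * β) * f (w + d) := hinv _ _ (hf _) s2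
          _ ≤ Real.exp (2 * β) * (Real.exp (2 * β * d) * f w) := by gcongr
          _ = _ := by ring
      · calc f w ≤ Real.exp (2 * β * d) * f (w + d) := i2
          _ ≤ Real.exp (2 * β * d) * (Real.exp (2 * β) * f (w + d + 1)) := by
            gcongr
            exact hinv _ _ (hf _) s1
          _ = _ := by ring
  rcases le_total w w' with hle | hle
  · obtain ⟨d, hd⟩ := Int.eq_ofNat_of_zero_le (sub_nonneg.2 hle)
    obtain rfl : w' = w + d := by omega
    have := (key d w hw hw').1
    simpa using this
  · obtain ⟨d, hd⟩ := Int.eq_ofNat_of_zero_le (sub_nonneg.2 hle)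
    obtain rfl : w = w' + d := by omega
    have := (key d w' hw' hw).2
    simpa using this

theorem abs_sub_le_of_step {V : ℤ → ℝ} {a R : ℝ}
    (h : ∀ w : ℤ, |(w : ℝ)| ≤ R → |((w + 1 : ℤ) : ℝ)| ≤ R → |V (w + 1) - V w| ≤ a) {w w' : ℤ}
    (hw : |(w : ℝ)| ≤ R) (hw' : |(w' : ℝ)| ≤ R) :
    |V w' - V w| ≤ a * |((w' - w : ℤ) : ℝ)| := by
  have key : ∀ (d : ℕ) (w : ℤ), |(w : ℝ)| ≤ R → |((w + d : ℤ) : ℝ)| ≤ R →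
      |V (w + d) - V w| ≤ a * d := by
    intro d
    induction d with
    | zero => intro w _ _; simp
    | succ d ih =>
      intro w h1 h2
      have h3 : |((w + d : ℤ) : ℝ)| ≤ R :=
        abs_intCast_le_of_between h1 h2 (by omega) (by push_cast; omega)
      have i1 := ih w h1 h3
      have s1 := h (w + d) h3 (by rw [add_assoc]; exact_mod_cast h2)
      have hw1 : w + ((d + 1 : ℕ) : ℤ) = w + d + 1 := by push_cast; ring
      rw [hw1]
      calc |V (w + d + 1) - V w| ≤ |V (w + d + 1) - V (w + d)| + |V (w + d) - V w| :=
            abs_sub_le _ _ _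
        _ ≤ a + a * d := add_le_add s1 i1
        _ = _ := by push_cast; ring
  rcases le_total w w' with hle | hle
  · obtain ⟨d, hd⟩ := Int.eq_ofNat_of_zero_le (sub_nonneg.2 hle)
    obtain rfl : w' = w + d := by omega
    simpa using key d w hw hw'
  · obtain ⟨d, hd⟩ := Int.eq_ofNat_of_zero_le (sub_nonneg.2 hle)
    obtain rfl : w = w' + d := by omega
    have := key d w' hw' hw
    rw [abs_sub_comm] at this
    simpa using this

theorem hypTail_succ (n : ℕ) (p : ℤ) (l : ℕ) (j : ℤ) :
    hypTail n p l j = hypPMF n p l j + hypTail n p l (j + 1) :=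
  sum_Icc_tail_succ l _ (hypPMF_of_notMem n p l) j

theorem binTail_succ (n : ℕ) (ε : ℝ) (j : ℤ) :
    binTail n ε j = binPMF n ε j + binTail n ε (j + 1) :=
  sum_Icc_tail_succ n _ (binPMF_of_notMem n ε) j

theorem binTail_nonneg (n : ℕ) {ε : ℝ} (hε : ε ∈ Set.Icc (-1 : ℝ) 1) (j : ℤ) :
    0 ≤ binTail n ε j :=
  Finset.sum_nonneg fun _ _ => binPMF_nonneg n hε _

theorem binTail_le_one (n : ℕ) {ε : ℝ} (hε : ε ∈ Set.Icc (-1 : ℝ) 1) (j : ℤ) :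
    binTail n ε j ≤ 1 := by
  rw [← sum_binPMF n ε, binTail_eq]
  apply Finset.sum_le_sum
  intro t _
  have := binPMF_nonneg n hε t
  split_ifs <;> linarith

theorem stepRatioBound_hypTail_neg {n l : ℕ} {p : ℤ} {θ R : ℝ} (hp : ((n : ℤ) + p) % 2 = 0)
    (hln : 2 * l ≤ n) (hpθ : |(p : ℝ)| ≤ θ * n) (hθ : 0 < θ) (hθ' : θ ≤ 1 / 64)
    (hl : 1 ≤ θ ^ 2 * l) (hR : R ≤ θ * l) :
    StepRatioBound (fun w => hypTail n p l (-w)) (64 * θ) R := by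
  intro w _ hw'
  have h := hypPMF_le_mul_hypTail hp hln hpθ hθ hθ' hl (-(w + 1))
    (by rw [Int.cast_neg, abs_neg]; exact hw'.trans hR)
  have hs := hypTail_succ n p l (-(w + 1))
  rw [show -(w + 1) + 1 = -w by ring] at hs
  have h0 := hypPMF_nonneg n p l (-(w + 1))
  have h1 := hypTail_nonneg n p l (-w)
  constructor
  · nlinarith [mul_nonneg hθ.le h1]
  · linarith

theorem stepRatioBound_one_sub_hypTail_neg {n l : ℕ} {p : ℤ} {θ R : ℝ}
    (hp : ((n : ℤ) + p) % 2 = 0) (hln : 2 * l ≤ n) (hpθ : |(p : ℝ)| ≤ θ * n) (hθ : 0 < θ)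
    (hθ' : θ ≤ 1 / 64) (hl : 1 ≤ θ ^ 2 * l) (hR : R ≤ θ * l) :
    StepRatioBound (fun w => 1 - hypTail n p l (-w)) (64 * θ) R := by
  intro w _ hw'
  have hpn : |(p : ℝ)| ≤ n := by
    have : (0 : ℝ) ≤ n := by positivity
    nlinarith
  have hp1 : -(n : ℤ) ≤ p := by exact_mod_cast (abs_le.1 hpn).1
  have hp2 : p ≤ n := by exact_mod_cast (abs_le.1 hpn).2
  have h := hypPMF_le_mul_hypTail (n := n) (p := -p) (by omega) hln (by simpa using hpθ)
    hθ hθ' hl (w + 1) (hw'.trans hR)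
  have hs := hypTail_succ n (-p) l (w + 1)
  have h0 := hypPMF_nonneg n (-p) l (w + 1)
  have h1 := hypTail_nonneg n (-p) l (w + 1 + 1)
  simp only [one_sub_hypTail n p l hp hp1 hp2 (by omega)]
  constructor
  · linarith
  · nlinarith [mul_nonneg hθ.le h1]

theorem abs_binTail_sub_le {N : ℕ} {ε θ R : ℝ} (hε : |ε| ≤ θ) (hθ : 0 < θ) (hθ' : θ ≤ 1 / 64)
    (hN : 1 ≤ θ ^ 2 * N) (hR : R ≤ θ * N) {w w' : ℤ} (hw : |(w : ℝ)| ≤ R)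
    (hw' : |(w' : ℝ)| ≤ R) :
    |binTail N ε (-w') - binTail N ε (-w)| ≤ 64 * θ * |((w' - w : ℤ) : ℝ)| := by
  refine abs_sub_le_of_step (V := fun w => binTail N ε (-w)) ?_ hw hw'
  intro w _ hw'
  have hε' : ε ∈ Set.Icc (-1 : ℝ) 1 := by
    obtain ⟨h1, h2⟩ := abs_le.1 hε
    constructor <;> linarith
  have h := binPMF_le_mul_binTail hε hθ hθ' hN (-(w + 1))
    (by rw [Int.cast_neg, abs_neg]; exact hw'.trans hR)
  have hs := binTail_succ N ε (-(w + 1))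
  rw [show -(w + 1) + 1 = -w by ring] at hs
  have h0 := binPMF_nonneg N hε' (-(w + 1))
  have h1 := binTail_le_one N hε' (-(w + 1))
  rw [hs, add_sub_cancel_right, abs_of_nonneg h0]
  refine h.trans ?_
  have : 64 * θ * binTail N ε (-(w + 1)) ≤ 64 * θ * 1 := by gcongr
  linarith

theorem abs_weighted_average_sub_average_le_of_mem_Icc {ι : Type*} (S : Finset ι) (P f V : ι → ℝ)
    (hP : ∀ z ∈ S, 0 ≤ P z) (hP1 : ∑ z ∈ S, P z = 1) (hf : ∀ z ∈ S, 0 ≤ f z)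
    (hD : 0 < ∑ z ∈ S, P z * f z) {u v : ℝ} (hV : ∀ z ∈ S, V z ∈ Set.Icc u v) :
    |(∑ z ∈ S, P z * f z * V z) / (∑ z ∈ S, P z * f z) - ∑ z ∈ S, P z * V z| ≤ v - u := by
  have h1 : (∑ z ∈ S, P z * f z * V z) / (∑ z ∈ S, P z * f z) ∈ Set.Icc u v := by
    constructor
    · rw [le_div_iff₀ hD, Finset.mul_sum]
      refine Finset.sum_le_sum fun z hz => ?_
      rw [mul_comm]
      exact mul_le_mul_of_nonneg_left (hV z hz).1 (mul_nonneg (hP z hz) (hf z hz))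
    · rw [div_le_iff₀ hD, Finset.mul_sum]
      refine Finset.sum_le_sum fun z hz => ?_
      rw [mul_comm v]
      exact mul_le_mul_of_nonneg_left (hV z hz).2 (mul_nonneg (hP z hz) (hf z hz))
  have h2 : ∑ z ∈ S, P z * V z ∈ Set.Icc u v := by
    constructor
    · calc u = ∑ z ∈ S, P z * u := by rw [← Finset.sum_mul, hP1, one_mul]
        _ ≤ _ := Finset.sum_le_sum fun z hz => mul_le_mul_of_nonneg_left (hV z hz).1 (hP z hz)
    · calc _ ≤ ∑ z ∈ S, P z * v :=
            Finset.sum_le_sum fun z hz => mul_le_mul_of_nonneg_left (hV z hz).2 (hP z hz)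
        _ = v := by rw [← Finset.sum_mul, hP1, one_mul]
  rw [abs_le]
  constructor <;> linarith [h1.1, h1.2, h2.1, h2.2]

/-- If `f` and `V` both vary slowly in the distance `d` from a base point, then reweighting by `f`
changes the average of `V` only to second order. -/
theorem abs_weighted_average_sub_average_le {ι : Type*} (S : Finset ι) (P f V d : ι → ℝ)
    (hP : ∀ z ∈ S, 0 ≤ P z) (hP1 : ∑ z ∈ S, P z = 1)
    (hd : ∀ z ∈ S, 0 ≤ d z) {f₀ V₀ a b σ M : ℝ} (ha : 0 ≤ a) (hb : 0 ≤ b) (hσ : 0 < σ)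
    (hf1 : ∀ z ∈ S, f z ≤ Real.exp (b * d z) * f₀)
    (hf2 : ∀ z ∈ S, f₀ ≤ Real.exp (b * d z) * f z)
    (hV : ∀ z ∈ S, |V z - V₀| ≤ a * d z) (hM : ∑ z ∈ S, P z * Real.exp (2 / σ * d z) ≤ M)
    (hbσ : b * σ ≤ 1) (hbM : b * σ * M ≤ 1 / 2) (hf₀ : 0 ≤ f₀) (hD : 0 < ∑ z ∈ S, P z * f z) :
    |(∑ z ∈ S, P z * f z * V z) / (∑ z ∈ S, P z * f z) - ∑ z ∈ S, P z * V z| ≤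
      2 * a * b * σ ^ 2 * (2 * M + M ^ 2) := by
  set D := ∑ z ∈ S, P z * f z with hDdef
  have hdσ : ∀ z ∈ S, d z ≤ σ * Real.exp (1 / σ * d z) := by
    intro z _
    have h := Real.add_one_le_exp (1 / σ * d z)
    calc d z = σ * (1 / σ * d z) := by field_simp
      _ ≤ _ := by gcongr; linarith
  have hdσ2 : ∀ z ∈ S, d z ^ 2 ≤ 2 * σ ^ 2 * Real.exp (1 / σ * d z) := by
    intro z hz
    have hnn : 0 ≤ 1 / σ * d z := mul_nonneg (by positivity) (hd z hz)
    have h := Real.quadratic_le_exp_of_nonneg hnn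
    calc d z ^ 2 = 2 * σ ^ 2 * ((1 / σ * d z) ^ 2 / 2) := by field_simp
      _ ≤ _ := by gcongr; linarith
  have hbexp : ∀ z ∈ S, Real.exp (b * d z) ≤ Real.exp (1 / σ * d z) := by
    intro z hz
    have : b ≤ 1 / σ := by rw [le_div_iff₀ hσ]; exact hbσ
    exact Real.exp_le_exp.2 (mul_le_mul_of_nonneg_right this (hd z hz))
  have hexp2 : ∀ z, Real.exp (1 / σ * d z) * Real.exp (1 / σ * d z) =
      Real.exp (2 / σ * d z) := by
    intro z; rw [← Real.exp_add]; ring_nf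
  have hM0 : 0 ≤ M := le_trans
    (Finset.sum_nonneg fun z hz => mul_nonneg (hP z hz) (Real.exp_pos _).le) hM
  have hdev : ∀ z ∈ S, |f z - f₀| ≤ f₀ * b * (d z * Real.exp (b * d z)) := by
    intro z hz
    have hbd : 0 ≤ b * d z := mul_nonneg hb (hd z hz)
    have hE : Real.exp (b * d z) - 1 ≤ b * d z * Real.exp (b * d z) := by
      have h := Real.add_one_le_exp (-(b * d z))
      rw [Real.exp_neg] at h
      have hpos := Real.exp_pos (b * d z)
      have h2 := mul_le_mul_of_nonneg_right h hpos.le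
      rw [inv_mul_cancel₀ hpos.ne'] at h2
      linarith
    have h1 := hf1 z hz
    have h2 : f₀ - f z ≤ f₀ * (b * d z) := by
      have h := Real.add_one_le_exp (-(b * d z))
      have h3 : f₀ * Real.exp (-(b * d z)) ≤ f z := by
        calc f₀ * Real.exp (-(b * d z))
            ≤ Real.exp (b * d z) * f z * Real.exp (-(b * d z)) := by gcongr; exact hf2 z hz
          _ = f z := by rw [mul_right_comm, ← Real.exp_add]; simp
      nlinarith
    have hE1 : 1 ≤ Real.exp (b * d z) := Real.one_le_exp hbd
    rw [abs_le]
    constructor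
    · have : f₀ * (b * d z) ≤ f₀ * (b * d z) * Real.exp (b * d z) :=
        le_mul_of_one_le_right (mul_nonneg hf₀ hbd) hE1
      linarith
    · have := mul_le_mul_of_nonneg_left hE hf₀
      linarith
  have hE1 : ∑ z ∈ S, P z * (d z * Real.exp (b * d z)) ≤ σ * M := by
    calc ∑ z ∈ S, P z * (d z * Real.exp (b * d z))
        ≤ ∑ z ∈ S, σ * (P z * Real.exp (2 / σ * d z)) := by
          refine Finset.sum_le_sum fun z hz => ?_
          calc P z * (d z * Real.exp (b * d z))
              ≤ P z * (σ * Real.exp (1 / σ * d z) * Real.exp (1 / σ * d z)) := by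
                refine mul_le_mul_of_nonneg_left ?_ (hP z hz)
                exact mul_le_mul (hdσ z hz) (hbexp z hz) (Real.exp_pos _).le (by positivity)
            _ = _ := by rw [mul_assoc σ, hexp2]; ring
      _ ≤ _ := by rw [← Finset.mul_sum]; gcongr
  have hE2 : ∑ z ∈ S, P z * (d z ^ 2 * Real.exp (b * d z)) ≤ 2 * σ ^ 2 * M := by
    calc ∑ z ∈ S, P z * (d z ^ 2 * Real.exp (b * d z))
        ≤ ∑ z ∈ S, 2 * σ ^ 2 * (P z * Real.exp (2 / σ * d z)) := by
          refine Finset.sum_le_sum fun z hz => ?_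
          calc P z * (d z ^ 2 * Real.exp (b * d z))
              ≤ P z * (2 * σ ^ 2 * Real.exp (1 / σ * d z) * Real.exp (1 / σ * d z)) := by
                refine mul_le_mul_of_nonneg_left ?_ (hP z hz)
                exact mul_le_mul (hdσ2 z hz) (hbexp z hz) (Real.exp_pos _).le (by positivity)
            _ = _ := by rw [mul_assoc (2 * σ ^ 2), hexp2]; ring
      _ ≤ _ := by rw [← Finset.mul_sum]; gcongr
  have hE0 : ∑ z ∈ S, P z * d z ≤ σ * M := by
    refine le_trans (Finset.sum_le_sum fun z hz => ?_) hE1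
    refine mul_le_mul_of_nonneg_left ?_ (hP z hz)
    exact le_mul_of_one_le_right (hd z hz) (Real.one_le_exp (mul_nonneg hb (hd z hz)))
  have hDdev : |D - f₀| ≤ f₀ * b * (σ * M) := by
    have : D - f₀ = ∑ z ∈ S, P z * (f z - f₀) := by
      simp only [mul_sub, Finset.sum_sub_distrib]
      rw [← Finset.sum_mul, hP1, one_mul]
    rw [this]
    calc |∑ z ∈ S, P z * (f z - f₀)| ≤ ∑ z ∈ S, |P z * (f z - f₀)| :=
          Finset.abs_sum_le_sum_abs _ _
      _ ≤ ∑ z ∈ S, f₀ * b * (P z * (d z * Real.exp (b * d z))) := by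
          refine Finset.sum_le_sum fun z hz => ?_
          rw [abs_mul, abs_of_nonneg (hP z hz)]
          calc P z * |f z - f₀| ≤ P z * (f₀ * b * (d z * Real.exp (b * d z))) :=
                mul_le_mul_of_nonneg_left (hdev z hz) (hP z hz)
            _ = _ := by ring
      _ ≤ _ := by rw [← Finset.mul_sum]; gcongr
  have hDlow : f₀ / 2 ≤ D := by
    have h1 := (abs_le.1 hDdev).1
    have h2 : f₀ * (b * σ * M) ≤ f₀ * (1 / 2) := by gcongr
    linarith
  have hcov : (∑ z ∈ S, P z * f z * V z) - D * ∑ z ∈ S, P z * V z =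
      ∑ z ∈ S, P z * ((f z - f₀) * (V z - V₀)) - (D - f₀) * ∑ z ∈ S, P z * (V z - V₀) := by
    have e1 : ∑ z ∈ S, P z * ((f z - f₀) * (V z - V₀)) =
        (∑ z ∈ S, P z * f z * V z) - V₀ * D - f₀ * (∑ z ∈ S, P z * V z) + f₀ * V₀ := by
      have : f₀ * V₀ = f₀ * V₀ * ∑ z ∈ S, P z := by rw [hP1, mul_one]
      rw [this, hDdef, Finset.mul_sum, Finset.mul_sum, Finset.mul_sum, ← Finset.sum_sub_distrib,
        ← Finset.sum_sub_distrib, ← Finset.sum_add_distrib]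
      exact Finset.sum_congr rfl fun z _ => by ring
    have e2 : ∑ z ∈ S, P z * (V z - V₀) = (∑ z ∈ S, P z * V z) - V₀ := by
      simp only [mul_sub, Finset.sum_sub_distrib]
      rw [← Finset.sum_mul, hP1, one_mul]
    rw [e1, e2]
    ring
  have hnum : |(∑ z ∈ S, P z * f z * V z) - D * ∑ z ∈ S, P z * V z| ≤
      f₀ * (a * b * σ ^ 2 * (2 * M + M ^ 2)) := by
    rw [hcov]
    have b1 : |∑ z ∈ S, P z * ((f z - f₀) * (V z - V₀))| ≤ f₀ * b * a * (2 * σ ^ 2 * M) := by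
      calc _ ≤ ∑ z ∈ S, |P z * ((f z - f₀) * (V z - V₀))| := Finset.abs_sum_le_sum_abs _ _
        _ ≤ ∑ z ∈ S, f₀ * b * a * (P z * (d z ^ 2 * Real.exp (b * d z))) := by
          refine Finset.sum_le_sum fun z hz => ?_
          rw [abs_mul, abs_of_nonneg (hP z hz), abs_mul]
          calc P z * (|f z - f₀| * |V z - V₀|)
              ≤ P z * (f₀ * b * (d z * Real.exp (b * d z)) * (a * d z)) := by
                refine mul_le_mul_of_nonneg_left ?_ (hP z hz)
                exact mul_le_mul (hdev z hz) (hV z hz) (abs_nonneg _)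
                  (le_trans (abs_nonneg _) (hdev z hz))
            _ = _ := by ring
        _ ≤ _ := by rw [← Finset.mul_sum]; gcongr
    have b2 : |∑ z ∈ S, P z * (V z - V₀)| ≤ a * (σ * M) := by
      calc _ ≤ ∑ z ∈ S, |P z * (V z - V₀)| := Finset.abs_sum_le_sum_abs _ _
        _ ≤ ∑ z ∈ S, a * (P z * d z) := by
          refine Finset.sum_le_sum fun z hz => ?_
          rw [abs_mul, abs_of_nonneg (hP z hz)]
          calc P z * |V z - V₀| ≤ P z * (a * d z) :=
                mul_le_mul_of_nonneg_left (hV z hz) (hP z hz)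
            _ = _ := by ring
        _ ≤ _ := by rw [← Finset.mul_sum]; gcongr
    calc _ ≤ |∑ z ∈ S, P z * ((f z - f₀) * (V z - V₀))| +
          |(D - f₀) * ∑ z ∈ S, P z * (V z - V₀)| := abs_sub _ _
      _ ≤ f₀ * b * a * (2 * σ ^ 2 * M) + f₀ * b * (σ * M) * (a * (σ * M)) := by
          rw [abs_mul]
          gcongr
      _ = _ := by ring
  have hX : 0 ≤ a * b * σ ^ 2 * (2 * M + M ^ 2) := by positivity
  rw [show (∑ z ∈ S, P z * f z * V z) / D - ∑ z ∈ S, P z * V z =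
    ((∑ z ∈ S, P z * f z * V z) - D * ∑ z ∈ S, P z * V z) / D by field_simp, abs_div,
    abs_of_pos hD, div_le_iff₀ hD]
  refine hnum.trans ?_
  nlinarith

theorem two_mul_sRound (m r : ℕ) : 2 * sRound m r = (m + 1 - r) * (m + 2 - r) := by
  have key : ∀ d r : ℕ, r + d = m + 1 → 2 * sRound m r = d * (d + 1) := by
    intro d
    induction d with
    | zero =>
      intro r hr
      rw [sRound, Finset.Icc_eq_empty (by omega)]
      simp
    | succ d ih =>
      intro r hr
      have h := ih (r + 1) (by omega)
      have hs : sRound m r = lRound m r + sRound m (r + 1) := by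
        rw [sRound, sRound, ← Finset.insert_Icc_succ_left_eq_Icc (by omega : r ≤ m),
          Finset.sum_insert (by simp)]
        rfl
      rw [hs, mul_add, h, lRound, show m + 1 - r = d + 1 by omega]
      ring
  by_cases hr : r ≤ m + 1
  · rw [key (m + 1 - r) r (by omega), show m + 2 - r = m + 1 - r + 1 by omega]
  · rw [sRound, Finset.Icc_eq_empty (by omega), show m + 1 - r = 0 by omega]
    simp

theorem sRound_eq_add (m r : ℕ) (hr : r ≤ m) : sRound m r = lRound m r + sRound m (r + 1) := by
  rw [sRound, sRound, ← Finset.insert_Icc_succ_left_eq_Icc hr, Finset.sum_insert (by simp)]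
  rfl

theorem sRound_anti (m : ℕ) {r r' : ℕ} (h : r ≤ r') : sRound m r' ≤ sRound m r :=
  Finset.sum_le_sum_of_subset (Finset.Icc_subset_Icc_left h)

theorem roundOminus_eq (m : ℕ) (ε : ℝ) (r : ℕ) (hr : r ≤ m) (y : ℤ) :
    roundOminus m ε r y = ∑ z ∈ Finset.Icc (-(lRound m r : ℤ)) (lRound m r),
      binPMF (lRound m r) ε z * binTail (sRound m (r + 1)) ε (-(y + z)) := by
  rw [roundOminus, binTail_eq, sRound_eq_add m r hr, ← sum_binPMF_mul_sum_binPMF]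
  refine Finset.sum_congr rfl fun z _ => ?_
  rw [binTail_eq]
  congr 1
  refine Finset.sum_congr rfl fun w _ => ?_
  congr 1
  simp only [neg_le_iff_add_nonneg]
  congr 1
  apply propext
  constructor <;> intro h <;> omega

theorem hyperHint_nonneg (m : ℕ) {p : ℤ} (hp : p % 2 = 0) (hp' : |p| ≤ 2 * sRound m 1)
    (r : ℕ) (y : ℤ) (hv : Bool) : 0 ≤ hyperHint m p r y hv := by
  obtain ⟨h1, h2⟩ := abs_le.1 hp'
  rw [hyperHint]
  split_ifs
  · exact hypTail_nonneg _ _ _ _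
  · have := sRound_anti m (show 1 ≤ r + 1 by omega)
    rw [one_sub_hypTail _ _ _ (by omega) (by push_cast; omega) (by push_cast; omega) (by omega)]
    exact hypTail_nonneg _ _ _ _

theorem sum_hyperHint (m : ℕ) (p : ℤ) (r : ℕ) (y : ℤ) :
    ∑ hv : Bool, hyperHint m p r y hv = 1 := by
  simp [hyperHint]

theorem sum_binPMF_exp_abs_le (n : ℕ) {ε : ℝ} (hε : ε ∈ Set.Icc (-1 : ℝ) 1) {t : ℝ} (ht : 0 ≤ t) :
    ∑ z ∈ Finset.Icc (-(n : ℤ)) n, binPMF n ε z * Real.exp (t * |(z : ℝ)|) ≤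
      2 * Real.exp (n * (t ^ 2 + |ε| * t)) := by
  calc ∑ z ∈ Finset.Icc (-(n : ℤ)) n, binPMF n ε z * Real.exp (t * |(z : ℝ)|)
      ≤ ∑ z ∈ Finset.Icc (-(n : ℤ)) n, (binPMF n ε z * Real.exp (t * z) +
          binPMF n ε z * Real.exp (-t * z)) := by
        refine Finset.sum_le_sum fun z _ => ?_
        rw [← mul_add]
        refine mul_le_mul_of_nonneg_left ?_ (binPMF_nonneg n hε z)
        rcases abs_cases (z : ℝ) with ⟨h, _⟩ | ⟨h, _⟩
        · rw [h]; linarith [Real.exp_pos (-t * z)]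
        · rw [h, show t * -(z : ℝ) = -t * z by ring]; linarith [Real.exp_pos (t * z)]
    _ ≤ Real.exp (n * (t ^ 2 + ε * t)) + Real.exp (n * ((-t) ^ 2 + ε * -t)) := by
        rw [Finset.sum_add_distrib]
        exact add_le_add (sum_binPMF_exp_le n hε t) (sum_binPMF_exp_le n hε (-t))
    _ ≤ Real.exp (n * (t ^ 2 + |ε| * t)) + Real.exp (n * (t ^ 2 + |ε| * t)) := by
        have h1 : ε * t ≤ |ε| * t := mul_le_mul_of_nonneg_right (le_abs_self ε) ht
        have h2 : ε * -t ≤ |ε| * t := by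
          have := mul_le_mul_of_nonneg_right (neg_abs_le ε) ht
          linarith
        rw [neg_sq]
        gcongr
    _ = _ := by ring

/-- Far from the decision boundary the hint is irrelevant. -/
theorem abs_roundO_sub_roundOminus_le_of_far {H : Type} {m r : ℕ} (hr : r ≤ m)
    {ε : ℝ} (hε : ε ∈ Set.Icc (-1 : ℝ) 1) {x : ℝ} (hx : 1 ≤ x) (hint : ℕ → ℤ → H → ℝ) (y : ℤ)
    (hv : H) (hnn : ∀ w, 0 ≤ hint r w hv)
    (hD : 0 < ∑ z ∈ Finset.Icc (-(lRound m r : ℤ)) (lRound m r : ℤ),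
      binPMF (lRound m r) ε z * hint r (y + z) hv)
    (hfar : 6 * lRound m r * x ≤ |y + ε * sRound m r|) :
    |roundO m ε hint r y hv - roundOminus m ε r y| ≤ Real.exp (-(4 * x ^ 2)) := by
  set k := lRound m r with hk
  set N := sRound m (r + 1) with hN
  have hk1 : 1 ≤ k := by rw [hk, lRound]; omega
  have hk1r : (1 : ℝ) ≤ k := by exact_mod_cast hk1
  have hNk : (N : ℝ) ≤ (k : ℝ) ^ 2 := by
    have h := two_mul_sRound m (r + 1)
    have h2 : 2 * N ≤ 2 * k ^ 2 := by
      rw [hN, h, hk, lRound, show m + 1 - (r + 1) = m - r by omega,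
        show m + 2 - (r + 1) = m - r + 1 by omega, show m + 1 - r = m - r + 1 by omega]
      nlinarith
    exact_mod_cast (by omega : N ≤ k ^ 2)
  have hs : (sRound m r : ℝ) = k + N := by exact_mod_cast sRound_eq_add m r hr
  have hkx : (k : ℝ) ≤ k * x := by nlinarith
  have hkε : |ε * k| ≤ k * x := by
    rw [abs_mul, Nat.abs_cast]
    have := abs_le.2 hε
    nlinarith
  have hNt : (N : ℝ) * (2 * x / k) ^ 2 ≤ 4 * x ^ 2 := by
    rw [div_pow, ← mul_div_assoc, div_le_iff₀ (by positivity)]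
    nlinarith [mul_le_mul_of_nonneg_left hNk (sq_nonneg x)]
  have hscale : ∀ u : ℝ, 4 * k * x ≤ u → 8 * x ^ 2 ≤ 2 * x / k * u := by
    intro u hu
    calc 8 * x ^ 2 = 2 * x / k * (4 * k * x) := by field_simp; ring
      _ ≤ _ := by gcongr
  have hz : ∀ z ∈ Finset.Icc (-(k : ℤ)) k, |(z : ℝ)| ≤ k * x := by
    intro z hz
    rw [Finset.mem_Icc] at hz
    have : |(z : ℝ)| ≤ k := by
      rw [abs_le]
      exact ⟨by exact_mod_cast hz.1, by exact_mod_cast hz.2⟩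
    linarith
  rw [roundO, roundOminus_eq m ε r hr]
  rcases le_abs'.1 hfar with hneg | hpos
  · have := abs_weighted_average_sub_average_le_of_mem_Icc (Finset.Icc (-(k : ℤ)) k)
      (binPMF k ε) (fun z => hint r (y + z) hv) (fun z => binTail N ε (-(y + z)))
      (fun z _ => binPMF_nonneg k hε z) (sum_binPMF k ε) (fun z _ => hnn _) hD
      (u := 0) (v := Real.exp (-(4 * x ^ 2))) ?_
    · simpa using this
    · intro z hzk
      refine ⟨binTail_nonneg N hε _, ?_⟩
      rw [binTail_eq]
      refine (sum_binPMF_indicator_le N hε (2 * x / k) (8 * x ^ 2) _ ?_ ?_).trans ?_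
      · intro t; split_ifs <;> norm_num
      · intro t ht
        rw [if_neg]
        intro hcon
        have hcon' : -((y : ℝ) + z) ≤ t := by exact_mod_cast hcon
        refine absurd (hscale (t - ε * N) ?_) (not_le.2 ht)
        have h1 := (abs_le.1 (hz z hzk)).2
        have h2 := (abs_le.1 hkε).1
        rw [hs] at hneg
        linarith
      · rw [Real.exp_le_exp]; linarith
  · have := abs_weighted_average_sub_average_le_of_mem_Icc (Finset.Icc (-(k : ℤ)) k)
      (binPMF k ε) (fun z => hint r (y + z) hv) (fun z => binTail N ε (-(y + z)))
      (fun z _ => binPMF_nonneg k hε z) (sum_binPMF k ε) (fun z _ => hnn _) hD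
      (u := 1 - Real.exp (-(4 * x ^ 2))) (v := 1) ?_
    · simpa using this
    · intro z hzk
      refine ⟨?_, binTail_le_one N hε _⟩
      have hcompl : 1 - binTail N ε (-(y + z)) = ∑ t ∈ Finset.Icc (-(N : ℤ)) N,
          binPMF N ε t * (if -(y + z) ≤ t then 0 else 1) := by
        rw [binTail_eq, sub_eq_iff_eq_add, ← Finset.sum_add_distrib]
        refine (sum_binPMF N ε).symm.trans (Finset.sum_congr rfl fun t _ => ?_)
        split_ifs <;> simp
      have hle : 1 - binTail N ε (-(y + z)) ≤ Real.exp (-(4 * x ^ 2)) := by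
        rw [hcompl]
        refine (sum_binPMF_indicator_le N hε (-(2 * x / k)) (8 * x ^ 2) _ ?_ ?_).trans ?_
        · intro t; split_ifs <;> norm_num
        · intro t ht
          rw [if_pos]
          by_contra hcon
          have hcon' : (t : ℝ) < -((y : ℝ) + z) := by exact_mod_cast not_le.1 hcon
          refine absurd (hscale (-(t - ε * N)) ?_) (not_le.2 (by linarith))
          have h1 := (abs_le.1 (hz z hzk)).1
          have h2 := (abs_le.1 hkε).2
          rw [hs] at hpos
          linarith
        · rw [neg_sq, Real.exp_le_exp]; linarith
      linarith

set_option maxHeartbeats 400000 in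
/-- Near the decision boundary the hint has a second-order effect. -/
theorem abs_roundO_sub_roundOminus_le_of_near {m r : ℕ} (hr1 : 1 ≤ r) (hr : r ≤ m)
    {ε : ℝ} (hε : ε ∈ Set.Icc (-1 : ℝ) 1) {x c C W M K : ℝ} (hx : 1 ≤ x) (hxm : x ^ 2 ≤ m)
    (hεx : |ε| ≤ 20 * x / m) {p : ℤ} (hp : p % 2 = 0) (hp' : |p| ≤ 2 * sRound m 1)
    (hpc : |(p : ℝ)| ≤ c * x * m) (hW1 : 20 ≤ W) (hWc : c ≤ W) (hWC : 4 * (C + 1) ≤ W)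
    (hM : 2 * Real.exp 44 ≤ M) (hK : (256 * W * M) ^ 2 ≤ K) (y : ℤ) (hv : Bool)
    (hD : 0 < ∑ z ∈ Finset.Icc (-(lRound m r : ℤ)) (lRound m r : ℤ),
      binPMF (lRound m r) ε z * hyperHint m p r (y + z) hv)
    (hnear : |(y : ℝ)| ≤ C * lRound m r * x) :
    |roundO m ε (hyperHint m p) r y hv - roundOminus m ε r y| ≤
      (K + 16384 * W ^ 2 * (2 * M + M ^ 2)) * (x ^ 2 / lRound m r) := by
  set k := lRound m r with hk
  set N := sRound m (r + 1) with hN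
  have hk1 : 1 ≤ k := by rw [hk, lRound]; omega
  have hkm : k ≤ m := by rw [hk, lRound]; omega
  have hk1r : (1 : ℝ) ≤ k := by exact_mod_cast hk1
  have hkmr : (k : ℝ) ≤ m := by exact_mod_cast hkm
  have hM2 : 2 ≤ M := by
    have := Real.one_le_exp (show (0 : ℝ) ≤ 44 by norm_num)
    linarith
  have hWM : 256 * W ≤ 256 * W * M := le_mul_of_one_le_right (by linarith) (by linarith)
  have hK1 : 256 * W * M ≤ K := (le_self_pow₀ (by linarith) two_ne_zero).trans hK
  have hKW : 256 * W ≤ K := hWM.trans hK1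
  have hnn := fun w => hyperHint_nonneg m hp hp' r w hv
  rw [roundO, roundOminus_eq m ε r hr]
  by_cases hsmall : (k : ℝ) < K * x ^ 2
  · have h1 := abs_weighted_average_sub_average_le_of_mem_Icc (Finset.Icc (-(k : ℤ)) k)
      (binPMF k ε) (fun z => hyperHint m p r (y + z) hv) (fun z => binTail N ε (-(y + z)))
      (fun z _ => binPMF_nonneg k hε z) (sum_binPMF k ε) (fun z _ => hnn _) hD
      (u := 0) (v := 1) (fun z _ => ⟨binTail_nonneg N hε _, binTail_le_one N hε _⟩)
    refine h1.trans ?_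
    have h2 : 1 ≤ K * (x ^ 2 / k) := by
      rw [← mul_div_assoc, le_div_iff₀ (by positivity)]
      linarith
    have h3 : 0 ≤ 16384 * W ^ 2 * (2 * M + M ^ 2) * (x ^ 2 / k) := by positivity
    linarith
  have hbig : K * x ^ 2 ≤ k := not_lt.1 hsmall
  have hx2 : x ≤ x ^ 2 := le_self_pow₀ hx two_ne_zero
  have hWk : 256 * W * x ≤ k := by
    refine le_trans ?_ hbig
    exact mul_le_mul hKW hx2 (by linarith) (by linarith)
  have hWx : W ≤ W * x := le_mul_of_one_le_right (by linarith) hx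
  have hk2r : (2 : ℝ) ≤ k := by linarith
  have hk2 : 2 ≤ k := by exact_mod_cast hk2r
  have h2N : (2 * N : ℝ) = k * (k - 1) := by
    have h := two_mul_sRound m (r + 1)
    rw [show m + 1 - (r + 1) = k - 1 by rw [hk, lRound]; omega,
      show m + 2 - (r + 1) = k by rw [hk, lRound]; omega] at h
    have h' : (2 * N : ℝ) = ((k - 1 : ℕ) : ℝ) * k := by exact_mod_cast h
    rw [h']
    push_cast [hk1]
    ring
  have hNk : (k : ℝ) ^ 2 / 4 ≤ N := by
    have := mul_le_mul_of_nonneg_right hk2r (by positivity : (0 : ℝ) ≤ k)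
    linarith
  have hNn : 2 * N ≤ 2 * sRound m 1 := by
    have := sRound_anti m (show 1 ≤ r + 1 by omega)
    omega
  have hn : ((2 * sRound m 1 : ℕ) : ℝ) = m * (m + 1) := by
    have h := two_mul_sRound m 1
    rw [show m + 1 - 1 = m by omega, show m + 2 - 1 = m + 1 by omega] at h
    rw [h]
    push_cast
    ring
  set θ := W * x / k with hθdef
  have hθ : 0 < θ := by positivity
  have hθk : θ * k = W * x := by rw [hθdef]; field_simp
  have hθ' : θ ≤ 1 / 128 := by
    rw [hθdef, div_le_iff₀ (by positivity)]
    linarith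
  have hθN : 1 ≤ θ ^ 2 * N := by
    have h1 : θ ^ 2 * ((k : ℝ) ^ 2 / 4) ≤ θ ^ 2 * N := by gcongr
    have h2 : θ ^ 2 * ((k : ℝ) ^ 2 / 4) = (W * x) ^ 2 / 4 := by rw [← hθk]; ring
    have h3 : (20 : ℝ) ^ 2 ≤ (W * x) ^ 2 := by
      gcongr
      linarith
    linarith
  have hR : (C + 1) * k * x ≤ θ * N := by
    calc (C + 1) * k * x ≤ W / 4 * k * x := by gcongr; linarith
      _ = θ * (k ^ 2 / 4) := by rw [← mul_div_assoc, pow_two, ← mul_assoc, hθk]; ring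
      _ ≤ _ := by gcongr
  have hεθ : |ε| ≤ θ := by
    refine hεx.trans ?_
    rw [hθdef]
    gcongr
  have hpθ : |(p : ℝ)| ≤ θ * (2 * sRound m 1 : ℕ) := by
    rw [hn]
    calc |(p : ℝ)| ≤ c * x * m := hpc
      _ ≤ W * x * m := by gcongr
      _ = θ * k * m := by rw [hθk]
      _ ≤ θ * (m + 1) * m := by gcongr; linarith
      _ = _ := by ring
  have hpar : (((2 * sRound m 1 : ℕ) : ℤ) + p) % 2 = 0 := by push_cast; omega
  have hstep : StepRatioBound (fun w => hyperHint m p r w hv) (64 * θ) ((C + 1) * k * x) := by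
    cases hv
    · simpa [hyperHint] using stepRatioBound_one_sub_hypTail_neg hpar hNn hpθ hθ (by linarith) hθN hR
    · simpa [hyperHint] using stepRatioBound_hypTail_neg hpar hNn hpθ hθ (by linarith) hθN hR
  have hkx : (k : ℝ) ≤ k * x := le_mul_of_one_le_right (by positivity) hx
  have hyR : |(y : ℝ)| ≤ (C + 1) * k * x := by linarith
  have hwin : ∀ z ∈ Finset.Icc (-(k : ℤ)) k, |((y + z : ℤ) : ℝ)| ≤ (C + 1) * k * x := by
    intro z hz
    rw [Finset.mem_Icc] at hz
    have : |(z : ℝ)| ≤ k := by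
      rw [abs_le]
      exact ⟨by exact_mod_cast hz.1, by exact_mod_cast hz.2⟩
    push_cast
    refine (abs_add_le _ _).trans ?_
    linarith
  have hσ : 0 < √(k : ℝ) := Real.sqrt_pos.2 (by linarith)
  have hσ2 : √(k : ℝ) ^ 2 = k := Real.sq_sqrt (by linarith)
  have hbM : 2 * (64 * θ) * √(k : ℝ) * M ≤ 1 / 2 := by
    have h1 : 256 * W * M * x ≤ √(k : ℝ) := by
      apply Real.le_sqrt_of_sq_le
      rw [mul_pow]
      refine le_trans ?_ hbig
      gcongr
    have h2 : θ * √(k : ℝ) * √(k : ℝ) = W * x := by rw [mul_assoc, ← sq, hσ2, hθk]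
    have h3 : 2 * (64 * θ) * √(k : ℝ) * M * √(k : ℝ) ≤ 1 / 2 * √(k : ℝ) := by
      calc 2 * (64 * θ) * √(k : ℝ) * M * √(k : ℝ) = 128 * M * (θ * √(k : ℝ) * √(k : ℝ)) := by ring
        _ = 128 * M * (W * x) := by rw [h2]
        _ ≤ _ := by linarith
    exact le_of_mul_le_mul_right h3 hσ
  have hbσ : 2 * (64 * θ) * √(k : ℝ) ≤ 1 := by
    have : 2 * (64 * θ) * √(k : ℝ) ≤ 2 * (64 * θ) * √(k : ℝ) * M :=
      le_mul_of_one_le_right (by positivity) (by linarith)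
    linarith
  have hMGF : ∑ z ∈ Finset.Icc (-(k : ℤ)) k,
      binPMF k ε z * Real.exp (2 / √(k : ℝ) * |(z : ℝ)|) ≤ M := by
    refine (sum_binPMF_exp_abs_le k hε (by positivity)).trans (le_trans ?_ hM)
    gcongr
    have h1 : (k : ℝ) * (2 / √(k : ℝ)) ^ 2 = 4 := by
      rw [div_pow, hσ2]; field_simp; norm_num
    have h2 : (k : ℝ) * (|ε| * (2 / √(k : ℝ))) = 2 * (√(k : ℝ) * |ε|) := by
      nth_rewrite 1 [← hσ2]
      field_simp
    have h3 : √(k : ℝ) * |ε| ≤ 20 := by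
      have hs1 : √(k : ℝ) ≤ √(m : ℝ) := Real.sqrt_le_sqrt hkmr
      have hs2 : x ≤ √(m : ℝ) := Real.le_sqrt_of_sq_le hxm
      have hm : (0 : ℝ) < m := by linarith
      calc √(k : ℝ) * |ε| ≤ √(m : ℝ) * (20 * √(m : ℝ) / m) := by
            gcongr
            refine hεx.trans ?_
            gcongr
        _ = 20 * (√(m : ℝ) * √(m : ℝ)) / m := by ring
        _ = 20 := by rw [Real.mul_self_sqrt hm.le]; field_simp
    linarith [h1, h2, h3, mul_add (k : ℝ) ((2 / √(k : ℝ)) ^ 2) (|ε| * (2 / √(k : ℝ)))]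
  have hmain := abs_weighted_average_sub_average_le (Finset.Icc (-(k : ℤ)) k)
    (binPMF k ε) (fun z => hyperHint m p r (y + z) hv) (fun z => binTail N ε (-(y + z)))
    (fun z => |(z : ℝ)|) (fun z _ => binPMF_nonneg k hε z) (sum_binPMF k ε)
    (fun z _ => abs_nonneg _) (f₀ := hyperHint m p r y hv) (V₀ := binTail N ε (-y))
    (a := 64 * θ) (b := 2 * (64 * θ)) (σ := √(k : ℝ)) (M := M) (by positivity) (by positivity) hσ
    (fun z hz => by
      have := hstep.le_exp_mul hnn (by positivity) (by linarith) hyR (hwin z hz)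
      simpa using this)
    (fun z hz => by
      have := hstep.le_exp_mul hnn (by positivity) (by linarith) (hwin z hz) hyR
      simpa using this)
    (fun z hz => by
      have := abs_binTail_sub_le hεθ hθ (by linarith) hθN hR hyR (hwin z hz)
      simpa using this)
    hMGF hbσ hbM (hnn y) hD
  refine hmain.trans ?_
  rw [hσ2]
  have h1 : 2 * (64 * θ) * (2 * (64 * θ)) * k * (2 * M + M ^ 2) =
      16384 * W ^ 2 * (2 * M + M ^ 2) * (x ^ 2 / k) := by
    rw [hθdef]; field_simp; norm_num
  rw [h1]
  have h2 : 0 ≤ K * (x ^ 2 / k) := by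
    have : 0 ≤ K := by linarith
    positivity
  linarith

/-- Anti-concentration of a nearly unbiased binomial. -/
theorem binPMF_le_of_abs_le {m N : ℕ} {ε x C : ℝ} (hε : ε ∈ Set.Icc (-1 : ℝ) 1) (hm : 0 < m)
    (hN : (m : ℝ) ^ 2 / 4 ≤ N) (hx : 1 ≤ x) (hεx : |ε| ≤ 20 * x / m) (hC : 5 ≤ C) (z : ℤ)
    (hz : |(z : ℝ)| ≤ C * m * x) : binPMF N ε z ≤ 256 * C * x / m := by
  have hmr : (0 : ℝ) < m := by exact_mod_cast hm
  have hle : binPMF N ε z ≤ binTail N ε z := by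
    rw [binTail_succ]
    linarith [binTail_nonneg N hε (z + 1)]
  have hle1 : binPMF N ε z ≤ 1 := hle.trans (binTail_le_one N hε z)
  set θ := 4 * C * x / m with hθdef
  have hθm : θ * m = 4 * C * x := by rw [hθdef]; field_simp
  have hθ : 0 < θ := by positivity
  have h256 : 256 * C * x / m = 64 * θ := by rw [hθdef]; ring
  rw [h256]
  by_cases hθ' : θ ≤ 1 / 64
  · have h := binPMF_le_mul_binTail (N := N) (ε := ε) (θ := θ) ?_ hθ hθ' ?_ z ?_
    · refine h.trans ?_
      have := mul_le_mul_of_nonneg_left (binTail_le_one N hε z) (by positivity : 0 ≤ 64 * θ)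
      linarith
    · refine hεx.trans ?_
      rw [hθdef]
      gcongr
      linarith
    · have h1 : θ ^ 2 * ((m : ℝ) ^ 2 / 4) ≤ θ ^ 2 * N := by gcongr
      have h2 : θ ^ 2 * ((m : ℝ) ^ 2 / 4) = (4 * C * x) ^ 2 / 4 := by rw [← hθm]; ring
      have h3 : 20 ≤ 4 * C * x := by nlinarith
      nlinarith
    · refine hz.trans ?_
      calc C * m * x = θ * (m ^ 2 / 4) := by
            rw [← mul_div_assoc, pow_two, ← mul_assoc, hθm]; ring
        _ ≤ _ := by gcongr
  · push Not at hθ'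
    linarith

/-- The rounds with (zero-based) index in `[a, b)`. -/
def rounds (m a b : ℕ) : Finset (Fin m) :=
  Finset.univ.filter (fun j : Fin m => a ≤ (j : ℕ) ∧ (j : ℕ) < b)

/-- The possible coin trajectories. -/
noncomputable def coinBox (m : ℕ) : Finset (Fin m → ℤ) :=
  Fintype.piFinset fun j : Fin m =>
    Finset.Icc (-(lRound m ((j : ℕ) + 1) : ℤ)) (lRound m ((j : ℕ) + 1))

/-- The probability of a coin trajectory. -/
noncomputable def coinProb (m : ℕ) (ε : ℝ) (x : Fin m → ℤ) : ℝ :=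
  ∏ j : Fin m, binPMF (lRound m ((j : ℕ) + 1)) ε (x j)

/-- The number of coins flipped in the rounds with index in `[a, b)`. -/
def coinCount (m a b : ℕ) : ℕ := ∑ j ∈ rounds m a b, lRound m ((j : ℕ) + 1)

theorem coinProb_nonneg (m : ℕ) {ε : ℝ} (hε : ε ∈ Set.Icc (-1 : ℝ) 1) (x : Fin m → ℤ) :
    0 ≤ coinProb m ε x :=
  Finset.prod_nonneg fun _ _ => binPMF_nonneg _ hε _

theorem sum_coinProb_mul (m : ℕ) (ε : ℝ) (a b : ℕ) (f : ℤ → ℝ) :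
    ∑ x ∈ coinBox m, coinProb m ε x * f (∑ j ∈ rounds m a b, x j) =
      ∑ z ∈ Finset.Icc (-(coinCount m a b : ℤ)) (coinCount m a b),
        binPMF (coinCount m a b) ε z * f z :=
  sum_piFinset_binPMF (fun j : Fin m => lRound m ((j : ℕ) + 1)) ε (rounds m a b) f

theorem sum_coinProb (m : ℕ) (ε : ℝ) : ∑ x ∈ coinBox m, coinProb m ε x = 1 := by
  have h := sum_coinProb_mul m ε 0 0 (fun _ => 1)
  simpa [sum_binPMF] using h

theorem sum_rounds_succ {M : Type*} [AddCommMonoid M] {m a b : ℕ} (hab : a ≤ b) (hb : b < m)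
    (f : Fin m → M) :
    ∑ j ∈ rounds m a (b + 1), f j = (∑ j ∈ rounds m a b, f j) + f ⟨b, hb⟩ := by
  have h : rounds m a (b + 1) = insert ⟨b, hb⟩ (rounds m a b) := by
    ext j
    simp only [rounds, Finset.mem_filter, Finset.mem_univ, true_and, Finset.mem_insert,
      Fin.ext_iff]
    omega
  rw [h, Finset.sum_insert (by simp [rounds]), add_comm]

theorem coinCount_add_sRound {m a b : ℕ} (hab : a ≤ b) (hb : b ≤ m) :
    coinCount m a b + sRound m (b + 1) = sRound m (a + 1) := by
  induction b, hab using Nat.le_induction with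
  | base =>
    have h : rounds m a a = ∅ := by
      ext j
      simp only [rounds, Finset.mem_filter, Finset.mem_univ, true_and, Finset.notMem_empty,
        iff_false]
      omega
    rw [coinCount, h, Finset.sum_empty, zero_add]
  | succ b hab ih =>
    rw [coinCount, sum_rounds_succ hab hb, add_assoc, ← ih (by omega),
      sRound_eq_add m (b + 1) hb]
    rfl

theorem partY_eq_add {m a b : ℕ} (hab : a ≤ b) (k₀ : ℤ) (x : Fin m → ℤ) :
    partY m k₀ x b = partY m k₀ x a + ∑ j ∈ rounds m a b, x j := by
  have h : (Finset.univ.filter fun j : Fin m => (j : ℕ) < b) =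
      (Finset.univ.filter fun j : Fin m => (j : ℕ) < a) ∪ rounds m a b := by
    ext j
    simp only [rounds, Finset.mem_filter, Finset.mem_univ, true_and, Finset.mem_union]
    omega
  rw [partY, partY, h, Finset.sum_union, add_assoc]
  rw [Finset.disjoint_left]
  intro j
  simp only [rounds, Finset.mem_filter, Finset.mem_univ, true_and]
  omega

theorem partY_zero_eq (m b : ℕ) (x : Fin m → ℤ) :
    partY m 0 x b = ∑ j ∈ rounds m 0 b, x j := by
  simp [partY, rounds]

theorem partY_succ {m : ℕ} (k₀ : ℤ) (x : Fin m → ℤ) (i : Fin m) :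
    partY m k₀ x ((i : ℕ) + 1) = partY m k₀ x i + x i := by
  rw [partY_eq_add (Nat.le_succ (i : ℕ)), sum_rounds_succ le_rfl i.2]
  have h : rounds m (i : ℕ) i = ∅ := by
    ext j
    simp only [rounds, Finset.mem_filter, Finset.mem_univ, true_and, Finset.notMem_empty,
      iff_false]
    omega
  rw [h, Finset.sum_empty, zero_add]

/-- Bounding the bias by a pathwise bound on the effect of a single hint. -/
theorem gameBias_le {H : Type} [Fintype H] {m : ℕ} {ε : ℝ} (hε : ε ∈ Set.Icc (-1 : ℝ) 1)
    {k₀ : ℤ} {hint : ℕ → ℤ → H → ℝ} (hnn : ∀ r y hv, 0 ≤ hint r y hv)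
    (hsum : ∀ r y, ∑ hv, hint r y hv = 1) (b : ℕ → ℤ → H → Bool) {B : (Fin m → ℤ) → ℝ}
    (hB0 : ∀ x, 0 ≤ B x)
    (hB : ∀ x ∈ coinBox m, ∀ (i : Fin m) (hv : H),
      0 < ∑ z ∈ Finset.Icc (-(lRound m ((i : ℕ) + 1) : ℤ)) (lRound m ((i : ℕ) + 1) : ℤ),
        binPMF (lRound m ((i : ℕ) + 1)) ε z * hint ((i : ℕ) + 1) (partY m k₀ x i + z) hv →
      |roundO m ε hint ((i : ℕ) + 1) (partY m k₀ x i) hv -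
        roundOminus m ε ((i : ℕ) + 1) (partY m k₀ x i)| ≤ B x) :
    gameBias m ε k₀ hint b ≤ ∑ x ∈ coinBox m, coinProb m ε x * B x := by
  classical
  have hT0 : ∀ x h, 0 ≤ trajProb m ε k₀ hint x h := fun x h =>
    Finset.prod_nonneg fun i _ => mul_nonneg (binPMF_nonneg _ hε _) (hnn _ _ _)
  have hgain : ∀ x ∈ coinBox m, ∀ h, |trajProb m ε k₀ hint x h * trajGain m ε k₀ hint b x h| ≤
      trajProb m ε k₀ hint x h * B x := by
    intro x hx h
    rw [abs_mul, abs_of_nonneg (hT0 x h)]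
    rcases (hT0 x h).eq_or_lt with h0 | hpos
    · rw [← h0, zero_mul, zero_mul]
    refine mul_le_mul_of_nonneg_left ?_ hpos.le
    rw [trajGain]
    split
    · rename_i i _
      refine hB x hx i (h i) ?_
      have hne := Finset.prod_ne_zero_iff.1 (ne_of_gt hpos) i (Finset.mem_univ i)
      have hle := Finset.single_le_sum
        (f := fun z => binPMF (lRound m ((i : ℕ) + 1)) ε z *
          hint ((i : ℕ) + 1) (partY m k₀ x i + z) (h i))
        (fun z _ => mul_nonneg (binPMF_nonneg _ hε _) (hnn _ _ _))
        (Fintype.mem_piFinset.1 hx i)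
      refine lt_of_lt_of_le ?_ hle
      rw [partY_succ] at hne
      exact lt_of_le_of_ne (mul_nonneg (binPMF_nonneg _ hε _) (hnn _ _ _)) (Ne.symm hne)
    · rw [abs_zero]
      exact hB0 x
  have hmarg : ∀ x, ∑ h, trajProb m ε k₀ hint x h = coinProb m ε x := by
    intro x
    simp only [trajProb, Finset.prod_mul_distrib]
    rw [← Finset.mul_sum, ← Fintype.piFinset_univ, ← Finset.prod_univ_sum]
    simp only [hsum, Finset.prod_const_one, mul_one]
    rfl
  rw [gameBias, tsum_eq_sum (s := coinBox m ×ˢ Finset.univ)]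
  · refine (Finset.abs_sum_le_sum_abs _ _).trans ?_
    rw [Finset.sum_product]
    refine Finset.sum_le_sum fun x hx => ?_
    rw [← hmarg, Finset.sum_mul]
    exact Finset.sum_le_sum fun h _ => hgain x hx h
  · rintro ⟨x, h⟩ hxh
    simp only [Finset.mem_product, Finset.mem_univ, and_true, coinBox, Fintype.mem_piFinset,
      not_forall] at hxh
    obtain ⟨j, hj⟩ := hxh
    rw [trajProb, Finset.prod_eq_zero (Finset.mem_univ j), zero_mul]
    rw [binPMF_of_notMem _ _ _ hj, zero_mul]

theorem coinCount_le_sq {m a b : ℕ} (ha : a < m) (hab : a ≤ b) (hb : b ≤ m) :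
    (coinCount m a b : ℝ) ≤ ((m : ℝ) - a) ^ 2 := by
  have h1 := coinCount_add_sRound hab hb
  have h2 := two_mul_sRound m (a + 1)
  rw [show m + 1 - (a + 1) = m - a by omega, show m + 2 - (a + 1) = m - a + 1 by omega] at h2
  have h3 : 2 * coinCount m a b ≤ 2 * (m - a) ^ 2 := by
    have h4 : (m - a) * (m - a + 1) ≤ 2 * (m - a) ^ 2 := by
      have : 1 ≤ m - a := by omega
      nlinarith
    omega
  rw [← Nat.cast_sub ha.le]
  exact_mod_cast (by omega : coinCount m a b ≤ (m - a) ^ 2)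

/-- Over the rounds from index `a` on, the coin sum rarely deviates from its mean. -/
theorem sum_coinProb_deviation_le {m a b : ℕ} (ha : a < m) (hab : a ≤ b) (hb : b ≤ m) {ε X : ℝ}
    (hε : ε ∈ Set.Icc (-1 : ℝ) 1) (hX : 0 < X) :
    ∑ x ∈ coinBox m, coinProb m ε x *
      (if 4 * ((m : ℝ) - a) * X ≤ |(∑ j ∈ rounds m a b, x j : ℤ) - ε * coinCount m a b|
        then 1 else 0) ≤ 2 * Real.exp (-(4 * X ^ 2)) := by
  set n := coinCount m a b with hn
  have hd : (0 : ℝ) < m - a := by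
    have : (a : ℝ) < m := by exact_mod_cast ha
    linarith
  have hnd : (n : ℝ) ≤ ((m : ℝ) - a) ^ 2 := coinCount_le_sq ha hab hb
  have hexp : (n : ℝ) * (2 * X / (m - a)) ^ 2 - 8 * X ^ 2 ≤ -(4 * X ^ 2) := by
    have : (n : ℝ) * (2 * X / (m - a)) ^ 2 ≤ ((m : ℝ) - a) ^ 2 * (2 * X / (m - a)) ^ 2 := by
      gcongr
    have h2 : ((m : ℝ) - a) ^ 2 * (2 * X / (m - a)) ^ 2 = 4 * X ^ 2 := by
      field_simp
      norm_num
    linarith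
  have hscale : ∀ u : ℝ, 4 * ((m : ℝ) - a) * X ≤ u → 8 * X ^ 2 ≤ 2 * X / (m - a) * u := by
    intro u hu
    calc 8 * X ^ 2 = 2 * X / (m - a) * (4 * ((m : ℝ) - a) * X) := by field_simp; norm_num
      _ ≤ _ := by gcongr
  rw [sum_coinProb_mul m ε a b (fun z =>
    if 4 * ((m : ℝ) - a) * X ≤ |(z : ℝ) - ε * n| then (1 : ℝ) else 0), ← hn]
  calc ∑ z ∈ Finset.Icc (-(n : ℤ)) n, binPMF n ε z *
        (if 4 * ((m : ℝ) - a) * X ≤ |(z : ℝ) - ε * n| then (1 : ℝ) else 0)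
      ≤ ∑ z ∈ Finset.Icc (-(n : ℤ)) n, (binPMF n ε z *
          (if 4 * ((m : ℝ) - a) * X ≤ (z : ℝ) - ε * n then (1 : ℝ) else 0) +
          binPMF n ε z *
          (if 4 * ((m : ℝ) - a) * X ≤ -((z : ℝ) - ε * n) then (1 : ℝ) else 0)) := by
        refine Finset.sum_le_sum fun z _ => ?_
        rw [← mul_add]
        refine mul_le_mul_of_nonneg_left ?_ (binPMF_nonneg n hε z)
        simp only [le_abs]
        split_ifs <;> first | (norm_num; done) | tauto
    _ ≤ Real.exp (-(4 * X ^ 2)) + Real.exp (-(4 * X ^ 2)) := by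
        rw [Finset.sum_add_distrib]
        refine add_le_add ?_ ?_
        · refine (sum_binPMF_indicator_le n hε (2 * X / (m - a)) (8 * X ^ 2) _ ?_ ?_).trans ?_
          · intro z; split_ifs <;> norm_num
          · intro z hz
            rw [if_neg fun h => absurd (hscale _ h) (not_le.2 hz)]
          · exact Real.exp_le_exp.2 hexp
        · refine (sum_binPMF_indicator_le n hε (-(2 * X / (m - a))) (8 * X ^ 2) _ ?_ ?_).trans ?_
          · intro z; split_ifs <;> norm_num
          · intro z hz
            rw [if_neg fun h => absurd (hscale _ h) (not_le.2 (by linarith))]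
          · rw [neg_sq]
            exact Real.exp_le_exp.2 hexp
    _ = _ := by ring

/-- A nearly unbiased coin sum is rarely within `C * k * X` of zero when `k` rounds are left. -/
theorem sum_coinProb_near_zero_le {m k : ℕ} (hk : 1 ≤ k) (hkm : k < m) {ε X C : ℝ}
    (hε : ε ∈ Set.Icc (-1 : ℝ) 1) (hX : 1 ≤ X) (hεX : |ε| ≤ 20 * X / m) (hC : 5 ≤ C) :
    ∑ x ∈ coinBox m, coinProb m ε x *
      (if |(partY m 0 x (m - k) : ℝ)| ≤ C * k * X then 1 else 0) ≤
        768 * C ^ 2 * k * X ^ 2 / m := by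
  have hm : (0 : ℝ) < m := by exact_mod_cast (by omega : 0 < m)
  have hkr : (1 : ℝ) ≤ k := by exact_mod_cast hk
  have hkmr : (k : ℝ) < m := by exact_mod_cast hkm
  by_cases hbig : m < 2 * k
  · have hbig' : (m : ℝ) < 2 * k := by exact_mod_cast hbig
    calc _ ≤ ∑ x ∈ coinBox m, coinProb m ε x := by
          refine Finset.sum_le_sum fun x _ => mul_le_of_le_one_right (coinProb_nonneg m hε x) ?_
          split_ifs <;> norm_num
      _ = 1 := sum_coinProb m ε
      _ ≤ _ := by
          rw [le_div_iff₀ hm]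
          have h1 : (1 : ℝ) ≤ C ^ 2 * X ^ 2 := by
            have h2 : (1 : ℝ) ≤ C ^ 2 := one_le_pow₀ (by linarith)
            have h3 : (1 : ℝ) ≤ X ^ 2 := one_le_pow₀ hX
            nlinarith
          nlinarith
  · set n := coinCount m 0 (m - k) with hn
    have hnm : (m : ℝ) ^ 2 / 4 ≤ n := by
      have h1 := coinCount_add_sRound (Nat.zero_le (m - k)) (by omega : m - k ≤ m)
      have h2 := two_mul_sRound m (0 + 1)
      have h3 := two_mul_sRound m (m - k + 1)
      rw [show m + 1 - (0 + 1) = m by omega, show m + 2 - (0 + 1) = m + 1 by omega] at h2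
      rw [show m + 1 - (m - k + 1) = k by omega, show m + 2 - (m - k + 1) = k + 1 by omega] at h3
      have h4 : k * (k + 1) + 2 * n = m * (m + 1) := by
        rw [hn]
        omega
      have h5 : (k * (k + 1) + 2 * n : ℝ) = m * (m + 1) := by exact_mod_cast h4
      have h6 : (2 * k : ℝ) ≤ m := by exact_mod_cast not_lt.1 hbig
      nlinarith
    simp only [partY_zero_eq]
    rw [sum_coinProb_mul m ε 0 (m - k) (fun z =>
      if |(z : ℝ)| ≤ C * k * X then (1 : ℝ) else 0), ← hn]
    have hR : 0 ≤ C * k * X := by positivity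
    have hsub : ∀ z : ℤ, |(z : ℝ)| ≤ C * k * X →
        z ∈ Finset.Icc (-⌊C * k * X⌋) ⌊C * k * X⌋ := by
      intro z hz
      rw [abs_le] at hz
      rw [Finset.mem_Icc]
      refine ⟨?_, Int.le_floor.2 hz.2⟩
      have : -z ≤ ⌊C * k * X⌋ := Int.le_floor.2 (by push_cast; linarith)
      omega
    calc ∑ z ∈ Finset.Icc (-(n : ℤ)) n, binPMF n ε z *
          (if |(z : ℝ)| ≤ C * k * X then (1 : ℝ) else 0)
        = ∑ z ∈ (Finset.Icc (-(n : ℤ)) n).filter (fun z : ℤ => |(z : ℝ)| ≤ C * k * X),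
            binPMF n ε z := by
          rw [Finset.sum_filter]
          refine Finset.sum_congr rfl fun z _ => ?_
          rw [mul_ite, mul_one, mul_zero]
      _ ≤ ∑ z ∈ (Finset.Icc (-(n : ℤ)) n).filter (fun z : ℤ => |(z : ℝ)| ≤ C * k * X),
            256 * C * X / m := by
          refine Finset.sum_le_sum fun z hz => ?_
          refine binPMF_le_of_abs_le hε (by omega) hnm hX hεX hC z ?_
          refine (Finset.mem_filter.1 hz).2.trans ?_
          gcongr
      _ ≤ ∑ z ∈ Finset.Icc (-⌊C * k * X⌋) ⌊C * k * X⌋, 256 * C * X / m := by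
          refine Finset.sum_le_sum_of_subset_of_nonneg
            (fun z hz => hsub z (Finset.mem_filter.1 hz).2) fun _ _ _ => by positivity
      _ ≤ (3 * (C * k * X)) * (256 * C * X / m) := by
          rw [Finset.sum_const, nsmul_eq_mul]
          refine mul_le_mul_of_nonneg_right ?_ (by positivity)
          have hf := Int.floor_le (C * k * X)
          have hf0 : 0 ≤ ⌊C * k * X⌋ := Int.floor_nonneg.2 hR
          have hcard : ((Finset.Icc (-⌊C * k * X⌋) ⌊C * k * X⌋).card : ℤ) =
              2 * ⌊C * k * X⌋ + 1 := by
            rw [Int.card_Icc]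
            omega
          have hcard' : ((Finset.Icc (-⌊C * k * X⌋) ⌊C * k * X⌋).card : ℝ) =
              2 * ⌊C * k * X⌋ + 1 := by exact_mod_cast hcard
          have h1 : 1 ≤ C * k * X := by
            have : 1 ≤ C * k := by nlinarith
            nlinarith
          rw [hcard']
          linarith
      _ = _ := by ring

theorem one_div_le_add_sum_sq {k m : ℕ} (hk : 1 ≤ k) (hkm : k ≤ m) :
    (1 : ℝ) / k ≤ 1 / m + ∑ j ∈ Finset.Ico k m, 1 / (j : ℝ) ^ 2 := by
  induction m, hkm using Nat.le_induction with
  | base => simp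
  | succ n hkn ih =>
    rw [Finset.sum_Ico_succ_top hkn]
    have hn : (1 : ℝ) ≤ n := by exact_mod_cast hk.trans hkn
    have h : (1 : ℝ) / n ≤ 1 / (n + 1) + 1 / (n : ℝ) ^ 2 := by
      rw [div_add_div _ _ (by positivity) (by positivity), div_le_div_iff₀ (by positivity)
        (by positivity)]
      nlinarith
    push_cast
    linarith

theorem abs_add_mul_sRound_of_large_drift {m i : ℕ} (hi : i < m) {ε X : ℝ} (hX : 1 ≤ X)
    (hεX : 20 * X / m < |ε|) (x : Fin m → ℤ)
    (hdev : |(∑ j ∈ rounds m 0 i, x j : ℤ) - ε * coinCount m 0 i| < 4 * m * X) :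
    6 * (lRound m (i + 1) : ℝ) * X ≤ |partY m 0 x i + ε * sRound m (i + 1)| := by
  have hm : (0 : ℝ) < m := by exact_mod_cast (by omega : 0 < m)
  have h1 := coinCount_add_sRound (Nat.zero_le i) hi.le
  have h2 := two_mul_sRound m (0 + 1)
  rw [show m + 1 - (0 + 1) = m by omega, show m + 2 - (0 + 1) = m + 1 by omega] at h2
  have h1' : (coinCount m 0 i : ℝ) + sRound m (i + 1) = sRound m (0 + 1) := by exact_mod_cast h1
  have h2' : (2 * sRound m (0 + 1) : ℝ) = m * (m + 1) := by exact_mod_cast h2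
  have hl : (lRound m (i + 1) : ℝ) ≤ m := by
    have : lRound m (i + 1) ≤ m := by rw [lRound]; omega
    exact_mod_cast this
  have hlX : (lRound m (i + 1) : ℝ) * X ≤ m * X := by gcongr
  rw [div_lt_iff₀ hm] at hεX
  have hs : 10 * m * X ≤ |ε * sRound m (0 + 1)| := by
    rw [abs_mul, Nat.abs_cast]
    have h3 : |ε| * (2 * sRound m (0 + 1)) = |ε| * m * (m + 1) := by rw [h2']; ring
    have h4 : 20 * X * m ≤ |ε| * m * (m + 1) := by
      have : 20 * X * m ≤ |ε| * m * m := by gcongr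
      have : 0 ≤ |ε| * m := by positivity
      linarith
    linarith
  rw [partY_zero_eq]
  have h5 : ε * (sRound m (0 + 1) : ℝ) = ((∑ j ∈ rounds m 0 i, x j : ℤ) + ε * sRound m (i + 1)) -
      ((∑ j ∈ rounds m 0 i, x j : ℤ) - ε * coinCount m 0 i) := by
    rw [← h1']; ring
  rw [h5] at hs
  have h6 := hs.trans (abs_sub _ _)
  linarith

/-- On paths with small deviations and little drift, the effect of a hint is controlled by how
often the path has been close to zero. -/
theorem near_of_small_drift {m i : ℕ} (hi : i < m) {ε X : ℝ} (hX : 1 ≤ X)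
    (hεX : |ε| ≤ 20 * X / m) (x : Fin m → ℤ)
    (hdev : ∀ a ≤ i, |(∑ j ∈ rounds m a i, x j : ℤ) - ε * coinCount m a i| <
      4 * ((m : ℝ) - a) * X)
    (hnear : |partY m 0 x i + ε * sRound m (i + 1)| < 6 * (lRound m (i + 1) : ℝ) * X) :
    |(partY m 0 x i : ℝ)| ≤ 26 * lRound m (i + 1) * X ∧
      ∀ k ∈ Finset.Ico (lRound m (i + 1)) m, |(partY m 0 x (m - k) : ℝ)| ≤ 50 * k * X := by
  have hm : (0 : ℝ) < m := by exact_mod_cast (by omega : 0 < m)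
  have hεm : |ε| * m ≤ 20 * X := by rwa [le_div_iff₀ hm] at hεX
  have hscale : ∀ k s : ℕ, k ≤ m → (s : ℝ) ≤ (k : ℝ) ^ 2 → |ε * s| ≤ 20 * k * X := by
    intro k s hk hs
    have hk' : (k : ℝ) ≤ m := by exact_mod_cast hk
    rw [abs_mul, Nat.abs_cast]
    calc |ε| * s ≤ |ε| * (k ^ 2) := by gcongr
      _ = |ε| * k * k := by ring
      _ ≤ |ε| * m * k := by gcongr
      _ ≤ 20 * X * k := by gcongr
      _ = _ := by ring
  have hl : lRound m (i + 1) = m - i := by rw [lRound]; omega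
  have h26 : |(partY m 0 x i : ℝ)| ≤ 26 * lRound m (i + 1) * X := by
    have h1 : |ε * sRound m (i + 1)| ≤ 20 * lRound m (i + 1) * X := by
      refine hscale _ _ (by omega) ?_
      have h2 := two_mul_sRound m (i + 1)
      rw [show m + 1 - (i + 1) = m - i by omega, show m + 2 - (i + 1) = m - i + 1 by omega] at h2
      have h3 : 1 ≤ m - i := by omega
      have h4 : sRound m (i + 1) ≤ (lRound m (i + 1)) ^ 2 := by
        rw [hl]
        nlinarith
      exact_mod_cast h4
    have h5 : (partY m 0 x i : ℝ) =
      (partY m 0 x i + ε * sRound m (i + 1)) - ε * sRound m (i + 1) := by ring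
    rw [h5]
    refine (abs_sub _ _).trans ?_
    linarith
  refine ⟨h26, fun k hk => ?_⟩
  rw [hl, Finset.mem_Ico] at hk
  have hkl : (lRound m (i + 1) : ℝ) * X ≤ k * X := by
    have : (lRound m (i + 1) : ℝ) ≤ k := by exact_mod_cast (by omega : lRound m (i + 1) ≤ k)
    gcongr
  have hcast : (m : ℝ) - (m - k : ℕ) = k := by
    rw [Nat.cast_sub hk.2.le]
    ring
  have h1 := hdev (m - k) (by omega)
  have h2 := hscale k _ hk.2.le
    (by simpa [hcast] using coinCount_le_sq (by omega : m - k < m) (by omega : m - k ≤ i) hi.le)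
  rw [hcast] at h1
  have h3 := partY_eq_add (by omega : m - k ≤ i) 0 x
  have h3' : (partY m 0 x i : ℝ) =
      partY m 0 x (m - k) + (∑ j ∈ rounds m (m - k) i, x j : ℤ) := by exact_mod_cast h3
  rw [abs_le] at h26 h2 ⊢
  rw [abs_lt] at h1
  constructor <;> linarith [h26.1, h26.2, h2.1, h2.2, h1.1, h1.2]

/-- The constant in the bound on the effect of a hint near the decision boundary. -/
noncomputable def nearConst (c : ℝ) : ℝ :=
  (256 * max 108 c * (2 * Real.exp 44)) ^ 2 +
    16384 * max 108 c ^ 2 * (2 * (2 * Real.exp 44) + (2 * Real.exp 44) ^ 2)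

theorem nearConst_pos (c : ℝ) : 0 < nearConst c := by
  have : 0 < max 108 c := lt_max_of_lt_left (by norm_num)
  rw [nearConst]
  positivity

theorem exp_neg_four_mul_le {m : ℕ} (hm : 2 ≤ m) :
    Real.exp (-(4 * Real.logb 2 m)) ≤ 1 / (m : ℝ) ^ 4 := by
  have hm0 : (0 : ℝ) < m := by exact_mod_cast (by omega : 0 < m)
  have hlog : Real.log m ≤ Real.logb 2 m := by
    have h1 : (1 : ℝ) ≤ m := by exact_mod_cast (by omega : 1 ≤ m)
    rw [Real.logb, le_div_iff₀ (Real.log_pos (by norm_num))]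
    have := Real.log_two_lt_d9
    exact mul_le_of_le_one_right (Real.log_nonneg h1) (by linarith)
  calc Real.exp (-(4 * Real.logb 2 m)) ≤ Real.exp (-(4 * Real.log m)) := by gcongr
    _ = 1 / (m : ℝ) ^ 4 := by
      rw [Real.exp_neg, one_div]
      congr 1
      rw [show 4 * Real.log m = ((4 : ℕ) : ℝ) * Real.log m by norm_num, Real.exp_nat_mul,
        Real.exp_log hm0]

theorem sum_inv_Ico_le {m : ℕ} (hm : 2 ≤ m) :
    ∑ k ∈ Finset.Ico 1 m, 1 / (k : ℝ) ≤ 2 * Real.logb 2 m := by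
  have h1 := harmonic_le_one_add_log m
  have hm1 : (1 : ℝ) ≤ m := by exact_mod_cast (by omega : 1 ≤ m)
  have hlog : Real.log m ≤ Real.logb 2 m := by
    rw [Real.logb, le_div_iff₀ (Real.log_pos (by norm_num))]
    have := Real.log_two_lt_d9
    exact mul_le_of_le_one_right (Real.log_nonneg hm1) (by linarith)
  have hL : 1 ≤ Real.logb 2 m := by
    rw [Real.le_logb_iff_rpow_le (by norm_num) (by linarith), Real.rpow_one]
    exact_mod_cast hm
  have h2 : ∑ k ∈ Finset.Ico 1 m, 1 / (k : ℝ) ≤ (harmonic m : ℝ) := by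
    rw [harmonic_eq_sum_Icc, Rat.cast_sum]
    simp only [Rat.cast_inv, Rat.cast_natCast, one_div]
    refine Finset.sum_le_sum_of_subset_of_nonneg ?_ fun _ _ _ => by positivity
    intro k
    rw [Finset.mem_Ico, Finset.mem_Icc]
    omega
  linarith

/-- The number of blocks of rounds over which the coin sum is far from its mean. -/
noncomputable def deviationCount (m : ℕ) (ε X : ℝ) (x : Fin m → ℤ) : ℝ :=
  ∑ a ∈ Finset.range m, ∑ b ∈ Finset.Icc a m,
    if 4 * ((m : ℝ) - a) * X ≤ |(∑ j ∈ rounds m a b, x j : ℤ) - ε * coinCount m a b|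
      then 1 else 0

/-- A weighted count of the rounds after which the coin sum is close to zero. -/
noncomputable def nearCount (m : ℕ) (X : ℝ) (x : Fin m → ℤ) : ℝ :=
  ∑ k ∈ Finset.Ico 1 m,
    1 / (k : ℝ) ^ 2 * if |(partY m 0 x (m - k) : ℝ)| ≤ 50 * k * X then 1 else 0

theorem deviationCount_nonneg (m : ℕ) (ε X : ℝ) (x : Fin m → ℤ) : 0 ≤ deviationCount m ε X x :=
  Finset.sum_nonneg fun _ _ => Finset.sum_nonneg fun _ _ => by split_ifs <;> norm_num

theorem nearCount_nonneg (m : ℕ) (X : ℝ) (x : Fin m → ℤ) : 0 ≤ nearCount m X x :=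
  Finset.sum_nonneg fun _ _ => mul_nonneg (by positivity) (by split_ifs <;> norm_num)

theorem abs_lt_or_one_le_deviationCount (m : ℕ) (ε X : ℝ) (x : Fin m → ℤ) :
    (∀ a b : ℕ, a < m → a ≤ b → b ≤ m →
      |(∑ j ∈ rounds m a b, x j : ℤ) - ε * coinCount m a b| < 4 * ((m : ℝ) - a) * X) ∨
      1 ≤ deviationCount m ε X x := by
  by_contra! hcon
  obtain ⟨⟨a, b, ha, hab, hb, hdev⟩, hlt⟩ := hcon
  refine absurd hlt (not_lt.2 ?_)
  have h1 := Finset.single_le_sum (f := fun b : ℕ =>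
      if 4 * ((m : ℝ) - a) * X ≤ |(∑ j ∈ rounds m a b, x j : ℤ) - ε * coinCount m a b|
        then (1 : ℝ) else 0)
    (fun _ _ => by split_ifs <;> norm_num) (Finset.mem_Icc.2 ⟨hab, hb⟩)
  have h2 := Finset.single_le_sum (f := fun a : ℕ => ∑ b ∈ Finset.Icc a m,
      if 4 * ((m : ℝ) - a) * X ≤ |(∑ j ∈ rounds m a b, x j : ℤ) - ε * coinCount m a b|
        then (1 : ℝ) else 0)
    (fun _ _ => Finset.sum_nonneg fun _ _ => by split_ifs <;> norm_num) (Finset.mem_range.2 ha)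
  simp only [if_pos hdev] at h1
  exact h1.trans h2

theorem sum_coinProb_mul_deviationCount_le {m : ℕ} (hm : 2 ≤ m) {ε : ℝ}
    (hε : ε ∈ Set.Icc (-1 : ℝ) 1) :
    ∑ x ∈ coinBox m, coinProb m ε x * deviationCount m ε √(Real.logb 2 m) x ≤ 4 / m := by
  have hmr : (2 : ℝ) ≤ m := by exact_mod_cast hm
  have hL : 0 < Real.logb 2 m := Real.logb_pos (by norm_num) (by linarith)
  have hX : 0 < √(Real.logb 2 m) := Real.sqrt_pos.2 hL
  simp only [deviationCount, Finset.mul_sum]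
  rw [Finset.sum_comm]
  calc _ ≤ ∑ a ∈ Finset.range m, (m + 1) * (2 * (1 / (m : ℝ) ^ 4)) := by
        refine Finset.sum_le_sum fun a ha => ?_
        rw [Finset.mem_range] at ha
        rw [Finset.sum_comm]
        calc _ ≤ ∑ b ∈ Finset.Icc a m, 2 * (1 / (m : ℝ) ^ 4) := by
              refine Finset.sum_le_sum fun b hb => ?_
              rw [Finset.mem_Icc] at hb
              refine (sum_coinProb_deviation_le ha hb.1 hb.2 hε hX).trans ?_
              rw [Real.sq_sqrt hL.le]
              gcongr
              exact exp_neg_four_mul_le hm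
          _ ≤ _ := by
              rw [Finset.sum_const, nsmul_eq_mul, Nat.card_Icc]
              gcongr
              exact_mod_cast (by omega : m + 1 - a ≤ m + 1)
    _ = (m * (m + 1)) * (2 / (m : ℝ) ^ 4) := by
        rw [Finset.sum_const, nsmul_eq_mul, Finset.card_range]
        ring
    _ ≤ _ := by
        rw [← mul_div_assoc, div_le_div_iff₀ (by positivity) (by positivity)]
        have h1 : (m : ℝ) * m * 2 ≤ m * m * (m * m) := by
          gcongr
          nlinarith
        nlinarith [mul_le_mul_of_nonneg_left h1 (by positivity : (0 : ℝ) ≤ m)]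

theorem sum_coinProb_mul_nearCount_le {m : ℕ} (hm : 2 ≤ m) {ε X : ℝ}
    (hε : ε ∈ Set.Icc (-1 : ℝ) 1) (hX : 1 ≤ X) (hεX : |ε| ≤ 20 * X / m) :
    ∑ x ∈ coinBox m, coinProb m ε x * nearCount m X x ≤
      3840000 * X ^ 2 * Real.logb 2 m / m := by
  simp only [nearCount, Finset.mul_sum]
  rw [Finset.sum_comm]
  calc _ ≤ ∑ k ∈ Finset.Ico 1 m, 1920000 * X ^ 2 / m * (1 / (k : ℝ)) := by
        refine Finset.sum_le_sum fun k hk => ?_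
        rw [Finset.mem_Ico] at hk
        have hk0 : (k : ℝ) ≠ 0 := by
          have : k ≠ 0 := by omega
          exact_mod_cast this
        have h := sum_coinProb_near_zero_le hk.1 hk.2 hε hX hεX (C := 50) (by norm_num)
        calc _ = 1 / (k : ℝ) ^ 2 * ∑ x ∈ coinBox m, coinProb m ε x *
              (if |(partY m 0 x (m - k) : ℝ)| ≤ 50 * k * X then 1 else 0) := by
              rw [Finset.mul_sum]
              refine Finset.sum_congr rfl fun x _ => ?_
              ring
          _ ≤ 1 / (k : ℝ) ^ 2 * (768 * 50 ^ 2 * k * X ^ 2 / m) := by gcongr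
          _ = _ := by
              field_simp
              norm_num
    _ = 1920000 * X ^ 2 / m * ∑ k ∈ Finset.Ico 1 m, 1 / (k : ℝ) := by rw [Finset.mul_sum]
    _ ≤ 1920000 * X ^ 2 / m * (2 * Real.logb 2 m) := by
        gcongr
        exact sum_inv_Ico_le hm
    _ = _ := by ring

theorem abs_roundO_sub_roundOminus_le_one {H : Type} {m r : ℕ} (hr : r ≤ m)
    {ε : ℝ} (hε : ε ∈ Set.Icc (-1 : ℝ) 1) (hint : ℕ → ℤ → H → ℝ) (y : ℤ)
    (hv : H) (hnn : ∀ w, 0 ≤ hint r w hv)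
    (hD : 0 < ∑ z ∈ Finset.Icc (-(lRound m r : ℤ)) (lRound m r : ℤ),
      binPMF (lRound m r) ε z * hint r (y + z) hv) :
    |roundO m ε hint r y hv - roundOminus m ε r y| ≤ 1 := by
  rw [roundO, roundOminus_eq m ε r hr]
  have := abs_weighted_average_sub_average_le_of_mem_Icc
    (Finset.Icc (-(lRound m r : ℤ)) (lRound m r)) (binPMF (lRound m r) ε)
    (fun z => hint r (y + z) hv) (fun z => binTail (sRound m (r + 1)) ε (-(y + z)))
    (fun z _ => binPMF_nonneg _ hε z) (sum_binPMF _ ε) (fun z _ => hnn _) hD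
    (u := 0) (v := 1) (fun z _ => ⟨binTail_nonneg _ hε _, binTail_le_one _ hε _⟩)
  simpa using this

theorem gameBias_le_of_large_drift {m : ℕ} (hm : 2 ≤ m) {ε : ℝ} (hε : ε ∈ Set.Icc (-1 : ℝ) 1)
    (hX : 1 ≤ √(Real.logb 2 m)) (hεX : 20 * √(Real.logb 2 m) / m < |ε|) {p : ℤ}
    (hp : p % 2 = 0) (hp' : |p| ≤ 2 * sRound m 1) (b : ℕ → ℤ → Bool → Bool) :
    gameBias m ε 0 (hyperHint m p) b ≤ 5 / m := by
  have hmr : (2 : ℝ) ≤ m := by exact_mod_cast hm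
  have hL : 0 < Real.logb 2 m := Real.logb_pos (by norm_num) (by linarith)
  set X := √(Real.logb 2 m) with hXdef
  have hnn := hyperHint_nonneg m hp hp'
  refine (gameBias_le hε hnn (sum_hyperHint m p) b
    (B := fun x => 1 / (m : ℝ) ^ 4 + deviationCount m ε X x)
    (fun x => add_nonneg (by positivity) (deviationCount_nonneg m ε X x)) ?_).trans ?_
  · intro x _ i hv hD
    rcases abs_lt_or_one_le_deviationCount m ε X x with hgood | hbad
    · have hdev := hgood 0 i (by omega) (Nat.zero_le _) i.2.le
      rw [Nat.cast_zero, sub_zero] at hdev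
      have h := abs_roundO_sub_roundOminus_le_of_far i.2 hε hX (hyperHint m p) (partY m 0 x i) hv
        (fun w => hnn _ w hv) hD (abs_add_mul_sRound_of_large_drift i.2 hX hεX x hdev)
      rw [hXdef, Real.sq_sqrt hL.le] at h
      have h2 := deviationCount_nonneg m ε X x
      have h3 := h.trans (exp_neg_four_mul_le hm)
      linarith
    · have h := abs_roundO_sub_roundOminus_le_one i.2 hε (hyperHint m p) (partY m 0 x i) hv
        (fun w => hnn _ w hv) hD
      have h2 : 0 ≤ 1 / (m : ℝ) ^ 4 := by positivity
      linarith
  · simp only [mul_add, Finset.sum_add_distrib, ← Finset.sum_mul, sum_coinProb, one_mul]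
    have h1 := sum_coinProb_mul_deviationCount_le hm hε
    have h2 : 1 / (m : ℝ) ^ 4 ≤ 1 / m := by
      gcongr
      exact le_self_pow₀ (by linarith) (by norm_num)
    calc _ ≤ 1 / (m : ℝ) + 4 / m := add_le_add h2 h1
      _ = _ := by ring

theorem gameBias_le_of_small_drift {m : ℕ} (hm : 2 ≤ m) {ε c : ℝ}
    (hε : ε ∈ Set.Icc (-1 : ℝ) 1) (hX : 1 ≤ √(Real.logb 2 m)) (hLm : Real.logb 2 m ≤ m)
    (hεX : |ε| ≤ 20 * √(Real.logb 2 m) / m) {p : ℤ} (hp : p % 2 = 0)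
    (hp' : |p| ≤ 2 * sRound m 1) (hpc : |(p : ℝ)| ≤ c * √(Real.logb 2 m) * m)
    (b : ℕ → ℤ → Bool → Bool) :
    gameBias m ε 0 (hyperHint m p) b ≤ 5 / m +
      nearConst c * Real.logb 2 m * (1 / m + 3840000 * Real.logb 2 m ^ 2 / m) := by
  have hmr : (2 : ℝ) ≤ m := by exact_mod_cast hm
  have hL : 0 < Real.logb 2 m := Real.logb_pos (by norm_num) (by linarith)
  set L := Real.logb 2 m with hLdef
  set X := √L with hXdef
  have hX2 : X ^ 2 = L := Real.sq_sqrt hL.le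
  have hc := nearConst_pos c
  have hnn := hyperHint_nonneg m hp hp'
  have hB : ∀ x : Fin m → ℤ, 0 ≤ nearConst c * L * (1 / m + nearCount m X x) := fun x =>
    mul_nonneg (by positivity) (add_nonneg (by positivity) (nearCount_nonneg m X x))
  refine (gameBias_le hε hnn (sum_hyperHint m p) b
    (B := fun x => 1 / (m : ℝ) ^ 4 + deviationCount m ε X x +
      nearConst c * L * (1 / m + nearCount m X x))
    (fun x => add_nonneg (add_nonneg (by positivity) (deviationCount_nonneg m ε X x)) (hB x))
    ?_).trans ?_
  · intro x _ i hv hD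
    have hdev0 := deviationCount_nonneg m ε X x
    have hBx := hB x
    have h40 : 0 ≤ 1 / (m : ℝ) ^ 4 := by positivity
    rcases abs_lt_or_one_le_deviationCount m ε X x with hgood | hbad
    · by_cases hfar : 6 * (lRound m ((i : ℕ) + 1) : ℝ) * X ≤
        |partY m 0 x i + ε * sRound m ((i : ℕ) + 1)|
      · have h := abs_roundO_sub_roundOminus_le_of_far i.2 hε hX (hyperHint m p)
          (partY m 0 x i) hv (fun w => hnn _ w hv) hD hfar
        rw [hX2] at h
        have h3 := h.trans (exp_neg_four_mul_le hm)
        linarith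
      · obtain ⟨h26, h50⟩ := near_of_small_drift i.2 hX hεX x
          (fun a ha => hgood a i (by omega) ha i.2.le) (not_le.1 hfar)
        have h := abs_roundO_sub_roundOminus_le_of_near (by omega) i.2 hε (C := 26)
          (W := max 108 c) (M := 2 * Real.exp 44)
          (K := (256 * max 108 c * (2 * Real.exp 44)) ^ 2) hX (by rw [hX2]; exact hLm) hεX hp hp'
          hpc ((by norm_num : (20 : ℝ) ≤ 108).trans (le_max_left _ _)) (le_max_right _ _)
          ((by norm_num : (4 * (26 + 1) : ℝ) ≤ 108).trans (le_max_left _ _)) le_rfl le_rfl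
          (partY m 0 x i) hv hD h26
        have hl1 : 1 ≤ lRound m ((i : ℕ) + 1) := by rw [lRound]; omega
        have hlm : lRound m ((i : ℕ) + 1) ≤ m := by rw [lRound]; omega
        have hsum : ∑ k ∈ Finset.Ico (lRound m ((i : ℕ) + 1)) m, 1 / (k : ℝ) ^ 2 ≤
            nearCount m X x := by
          calc _ = ∑ k ∈ Finset.Ico (lRound m ((i : ℕ) + 1)) m, 1 / (k : ℝ) ^ 2 *
                (if |(partY m 0 x (m - k) : ℝ)| ≤ 50 * k * X then 1 else 0) := by
                refine Finset.sum_congr rfl fun k hk => ?_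
                rw [if_pos (h50 k hk), mul_one]
            _ ≤ _ := by
                refine Finset.sum_le_sum_of_subset_of_nonneg
                  (Finset.Ico_subset_Ico_left hl1) fun _ _ _ => ?_
                exact mul_nonneg (by positivity) (by split_ifs <;> norm_num)
        have hinv := (one_div_le_add_sum_sq hl1 hlm).trans (add_le_add_right hsum _)
        have h4 : nearConst c * (X ^ 2 / lRound m ((i : ℕ) + 1)) ≤
            nearConst c * L * (1 / m + nearCount m X x) := by
          rw [hX2, mul_assoc, div_eq_mul_one_div]
          gcongr
        have h5 := h.trans h4
        linarith
    · have h := abs_roundO_sub_roundOminus_le_one i.2 hε (hyperHint m p) (partY m 0 x i) hv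
        (fun w => hnn _ w hv) hD
      linarith
  · have h1 := sum_coinProb_mul_deviationCount_le hm hε
    have h2 : 1 / (m : ℝ) ^ 4 ≤ 1 / m := by
      gcongr
      exact le_self_pow₀ (by linarith) (by norm_num)
    have h3 := sum_coinProb_mul_nearCount_le hm hε hX hεX
    rw [hX2, ← hLdef] at h3
    calc _ = 1 / (m : ℝ) ^ 4 + ∑ x ∈ coinBox m, coinProb m ε x * deviationCount m ε X x +
          nearConst c * L * (1 / m + ∑ x ∈ coinBox m, coinProb m ε x * nearCount m X x) := by
          have h4 : ∀ x : Fin m → ℤ, coinProb m ε x * (1 / (m : ℝ) ^ 4 + deviationCount m ε X x +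
              nearConst c * L * (1 / m + nearCount m X x)) =
              coinProb m ε x * (1 / (m : ℝ) ^ 4 + nearConst c * L * (1 / m)) +
              coinProb m ε x * deviationCount m ε X x +
              nearConst c * L * (coinProb m ε x * nearCount m X x) := fun x => by ring
          simp only [h4, Finset.sum_add_distrib]
          rw [← Finset.sum_mul, sum_coinProb, ← Finset.mul_sum]
          ring
      _ ≤ 1 / (m : ℝ) + 4 / m + nearConst c * L * (1 / m + 3840000 * L * L / m) := by gcongr
      _ = _ := by ring

theorem stmt_17 :
    ∃ φ : ℝ → ℝ, (∀ c : ℝ, 0 < c → 0 < φ c) ∧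
      ∀ c : ℝ, 0 < c → ∀ m : ℕ, 2 ≤ m → ∀ ε : ℝ, ε ∈ Set.Icc (-1 : ℝ) 1 →
        ∀ p : ℤ, p % 2 = 0 →
          |(p : ℝ)| ≤ c * Real.sqrt (Real.logb 2 m * (sRound m 1 : ℝ)) →
          |(p : ℝ)| ≤ 2 * (sRound m 1 : ℝ) →
          ∀ b : ℕ → ℤ → Bool → Bool,
            gameBias m ε 0 (hyperHint m p) b ≤ φ c * Real.logb 2 m ^ 3 / m := by
  refine ⟨fun c => 5 + 3840001 * nearConst c, fun c _ => by have := nearConst_pos c; positivity,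
    ?_⟩
  intro c hc m hm ε hε p hp hpc hps b
  have hmr : (2 : ℝ) ≤ m := by exact_mod_cast hm
  have hm0 : (0 : ℝ) < m := by linarith
  have hL1 : 1 ≤ Real.logb 2 m := by
    rw [Real.le_logb_iff_rpow_le (by norm_num) hm0, Real.rpow_one]
    exact hmr
  have hLm : Real.logb 2 m ≤ m := by
    rw [Real.logb_le_iff_le_rpow (by norm_num) hm0, Real.rpow_natCast]
    exact_mod_cast Nat.lt_two_pow_self.le
  have hX : 1 ≤ √(Real.logb 2 m) := Real.one_le_sqrt.2 hL1
  have hp' : |p| ≤ 2 * sRound m 1 := by exact_mod_cast hps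
  have hpc' : |(p : ℝ)| ≤ c * √(Real.logb 2 m) * m := by
    refine hpc.trans ?_
    rw [mul_assoc, Real.sqrt_mul (by linarith)]
    gcongr
    refine Real.sqrt_le_iff.2 ⟨hm0.le, ?_⟩
    have h := two_mul_sRound m 1
    rw [show m + 1 - 1 = m by omega, show m + 2 - 1 = m + 1 by omega] at h
    have h' : (2 * sRound m 1 : ℝ) = m * (m + 1) := by exact_mod_cast h
    nlinarith
  set L := Real.logb 2 m with hL
  have hcc := nearConst_pos c
  have hL13 : 1 ≤ L ^ 3 := one_le_pow₀ hL1
  rcases le_or_gt |ε| (20 * √L / m) with hεX | hεX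
  · refine (gameBias_le_of_small_drift hm hε hX hLm hεX hp hp' hpc' b).trans ?_
    rw [← hL]
    have h1 : L ≤ L ^ 3 := le_self_pow₀ hL1 (by norm_num)
    have h2 := mul_le_mul_of_nonneg_left h1 hcc.le
    calc 5 / m + nearConst c * L * (1 / m + 3840000 * L ^ 2 / m)
        = (5 * 1 + nearConst c * L + 3840000 * nearConst c * L ^ 3) / m := by ring
      _ ≤ (5 + 3840001 * nearConst c) * L ^ 3 / m := by
          gcongr
          linarith
  · refine (gameBias_le_of_large_drift hm hε hX hεX hp hp' b).trans ?_
    dsimp only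
    gcongr
    nlinarith
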